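/- arXiv:1905.01225 — 5 statements merged into one kernel-verified Lean document; each statement's English description precedes it below -/
import Mathlib

section
/- Let $d$ be a square-free integer with $d \equiv 1 \pmod 4$. Then the relative discriminant of the extension $\mathbb{Q}(\zeta_8, \sqrt{d})/\mathbb{Q}(\zeta_8)$ is generated by $d$. -/
open NumberField

lemma aux_red {R : Type*} [CommRing R] [IsReduced R] (h2 : ∀ x : R, 2 * x = 0 → x = 0)
    (a b c e : R) (h0 : a^2 - c^2 - 2*b*e = 0) (h1 : 2*(a*b - c*e) = 0)
    (h3 : 2*a*c + b^2 - e^2 = 0) (h4 : 2*(a*e+b*c) = 0) : a = 0 ∧ b = 0 ∧ c = 0 ∧ e = 0 := by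
  have hr : ∀ (x : R) (n : ℕ), x ^ n = 0 → x = 0 := fun x n h => IsNilpotent.eq_zero ⟨n, h⟩
  have key : ∀ x y : R, x^3 - 3*x*y^2 = 0 → 3*x^2*y - y^3 = 0 → x = 0 ∧ y = 0 := by
    intro x y p q
    have h : 2 * (2 * (2 * (x*y^4))) = 0 := by
      linear_combination (-3*y^2) * p + (x*y) * q
    have h := h2 _ (h2 _ (h2 _ h))
    have h' : x * y = 0 := hr _ 4 (by linear_combination x^3 * h)
    refine ⟨hr _ 3 (by linear_combination p + 3*y*h'), hr _ 3 (by linear_combination 3*x*h' - q)⟩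
  have h1 := h2 _ h1
  have h4 := h2 _ h4
  obtain ⟨ha, hc⟩ := key a c
    (by linear_combination a*h0 - c*h3 + b*h4 + e*h1)
    (by linear_combination a*h3 + c*h0 - b*h1 + e*h4)
  obtain ⟨hb, he⟩ := key b e
    (by subst ha hc; linear_combination b*h3 + e*h0)
    (by subst ha hc; linear_combination e*h3 - b*h0)
  exact ⟨ha, hb, hc, he⟩

lemma aux_int (d : ℤ) (hd : Squarefree d) (hd4 : d % 4 = 1)
    (a b c e : ℤ) (h0 : d ∣ a^2 - c^2 - 2*b*e) (h1 : d ∣ 2*(a*b - c*e))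
    (h3 : d ∣ 2*a*c + b^2 - e^2) (h4 : d ∣ 2*(a*e+b*c)) : d ∣ a ∧ d ∣ b ∧ d ∣ c ∧ d ∣ e := by
  have : IsReduced (ℤ ⧸ Ideal.span {d}) := by
    rw [← Ideal.isRadical_iff_quotient_reduced, ← isRadical_iff_span_singleton]
    exact hd.isRadical
  have hz : ∀ x : ℤ, d ∣ x ↔ (Ideal.Quotient.mk (Ideal.span {d}) x) = 0 := fun x => by
    rw [Ideal.Quotient.eq_zero_iff_mem, Ideal.mem_span_singleton]
  rw [hz] at h0 h1 h3 h4
  simp only [hz]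
  simp only [map_add, map_sub, map_mul, map_pow, map_ofNat] at h0 h1 h3 h4
  refine aux_red ?_ _ _ _ _ h0 h1 h3 h4
  intro x hx
  obtain ⟨x, rfl⟩ := Ideal.Quotient.mk_surjective x
  rw [← map_ofNat (Ideal.Quotient.mk (Ideal.span {d})) 2, ← map_mul, ← hz] at hx
  rw [← hz]
  obtain ⟨k, hk⟩ := hx
  obtain ⟨m, hm⟩ : ∃ m, d = 2 * m + 1 := ⟨d / 2, by omega⟩
  exact ⟨x - m * k, by linear_combination (-m) * hk - x * hm⟩

lemma aux_K (d : ℤ) (hd : Squarefree d) (hd4 : d % 4 = 1)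
    (K : Type) [Field K] [NumberField K] (ζ : K) (hζ : IsPrimitiveRoot ζ 8)
    (hK : Algebra.adjoin ℚ {ζ} = ⊤) (y : 𝓞 K) (h : (d : 𝓞 K) ∣ y ^ 2) : (d : 𝓞 K) ∣ y := by
  have : IsCyclotomicExtension {8} ℚ K := by
    refine ⟨fun {n} hn _ => ⟨ζ, by rw [Set.mem_singleton_iff.mp hn]; exact hζ⟩, fun x => ?_⟩
    have hx : x ∈ Algebra.adjoin ℚ {ζ} := hK ▸ Algebra.mem_top
    refine Algebra.adjoin_mono ?_ hx
    rintro _ rfl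
    exact ⟨8, rfl, by norm_num, hζ.pow_eq_one⟩
  have hdim : hζ.integralPowerBasis.dim = 4 := by
    rw [hζ.integralPowerBasis_dim]; decide
  let B := hζ.integralPowerBasis.basis.reindex (finCongr hdim)
  have hB : ∀ i, B i = hζ.toInteger ^ (i : ℕ) := by
    intro i; simp [B]
  set z := hζ.toInteger with hz
  have hz4 : z ^ 4 = -1 := by
    have hp : IsPrimitiveRoot z 8 := hζ.toInteger_isPrimitiveRoot
    have h8 : (z^4 - 1) * (z^4 + 1) = 0 := by linear_combination hp.pow_eq_one
    rcases mul_eq_zero.mp h8 with h | h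
    · exact absurd (sub_eq_zero.mp h) (hp.pow_ne_one_of_pos_of_lt (by norm_num) (by norm_num))
    · linear_combination h
  have hexp : ∀ w : 𝓞 K, ∃ a b c e : ℤ, w = a + b * z + c * z^2 + e * z^3 := by
    intro w
    refine ⟨B.repr w 0, B.repr w 1, B.repr w 2, B.repr w 3, ?_⟩
    conv_lhs => rw [← B.sum_repr w]
    simp [Fin.sum_univ_four, hB]
  have hli : ∀ a b c e : ℤ, (a + b * z + c * z^2 + e * z^3 : 𝓞 K) = 0 →
      a = 0 ∧ b = 0 ∧ c = 0 ∧ e = 0 := by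
    intro a b c e h
    have := Fintype.linearIndependent_iff.mp B.linearIndependent ![a,b,c,e]
      (by simpa [Fin.sum_univ_four, hB] using h)
    exact ⟨this 0, this 1, this 2, this 3⟩
  obtain ⟨w, hw⟩ := h
  obtain ⟨a, b, c, e, rfl⟩ := hexp y
  obtain ⟨a', b', c', e', rfl⟩ := hexp w
  obtain ⟨k0, k1, k2, k3⟩ := hli (a^2 - c^2 - 2*b*e - d * a') (2*(a*b - c*e) - d * b')
    (2*a*c + b^2 - e^2 - d * c') (2*(a*e+b*c) - d*e') (by
      push_cast
      linear_combination hw - ((c:𝓞 K)^2+2*b*e+2*c*e*z+e^2*z^2) * hz4)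
  obtain ⟨⟨a, rfl⟩, ⟨b, rfl⟩, ⟨c, rfl⟩, ⟨e, rfl⟩⟩ := aux_int d hd hd4 a b c e ⟨a', by linarith⟩ ⟨b', by linarith⟩
    ⟨c', by linarith⟩ ⟨e', by linarith⟩
  exact ⟨a + b * z + c * z^2 + e * z^3, by push_cast; ring⟩

lemma lift_int {K : Type} [Field K] {x : K} (h : IsIntegral ℤ x) :
    ∃ y : 𝓞 K, algebraMap (𝓞 K) K y = x := ⟨⟨x, h⟩, rfl⟩

lemma ext_int {K : Type} [Field K] {x y : 𝓞 K}
    (h : algebraMap (𝓞 K) K x = algebraMap (𝓞 K) K y) : x = y :=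
  RingOfIntegers.coe_injective h

open Polynomial in
theorem stmt_0 (d : ℤ) (hd : Squarefree d) (hd4 : d % 4 = 1)
    (K L : Type) [Field K] [NumberField K] [Field L] [NumberField L] [Algebra K L]
    [Module.Finite (𝓞 K) (𝓞 L)] [Module.Free (𝓞 K) (𝓞 L)]
    (ζ : K) (hζ : IsPrimitiveRoot ζ 8) (hK : Algebra.adjoin ℚ {ζ} = ⊤)
    (s : L) (hs : s ^ 2 = (d : L)) (hL : Algebra.adjoin K {s} = ⊤) :
    Ideal.relNorm (𝓞 K) (differentIdeal (𝓞 K) (𝓞 L)) = Ideal.span {(d : 𝓞 K)} := by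
  have hrad := aux_K d hd hd4 K ζ hζ hK
  have hd0 : d ≠ 0 := by rintro rfl; simp at hd4
  have hd0K : (d : K) ≠ 0 := by exact_mod_cast hd0
  have hd0O : (d : 𝓞 K) ≠ 0 := by exact_mod_cast hd0
  by_cases hex : ∃ t : K, t ^ 2 = d
  · -- trivial case
    obtain ⟨t, ht⟩ := hex
    have hu : IsUnit (d : 𝓞 K) := by
      have hti : IsIntegral ℤ t := by
        refine IsIntegral.of_pow (n := 2) (by norm_num) ?_
        rw [ht]; exact isIntegral_algebraMap (R := ℤ) (x := d)
      obtain ⟨τ, hτ⟩ := lift_int hti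
      have e : τ ^ 2 = d := by
        apply ext_int; rw [map_pow, hτ, ht, map_intCast]
      obtain ⟨k, hk⟩ := hrad τ (by rw [e])
      rw [hk] at e
      refine IsUnit.of_mul_eq_one (k ^ 2) (mul_left_cancel₀ hd0O ?_)
      linear_combination e
    have h1 : Algebra.adjoin K {algebraMap (𝓞 L) L 1} = ⊤ := by
      rw [eq_top_iff, ← hL]
      refine Algebra.adjoin_le ?_
      intro u hu'
      rw [Set.mem_singleton_iff.mp hu']
      have : (s - algebraMap K L t) * (s + algebraMap K L t) = 0 := by
        have := congrArg (algebraMap K L) ht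
        simp only [map_pow, map_intCast] at this
        linear_combination hs - this
      rcases mul_eq_zero.mp this with h | h
      · rw [sub_eq_zero.mp h]; exact Subalgebra.algebraMap_mem _ _
      · rw [eq_neg_of_add_eq_zero_left h]; exact neg_mem (Subalgebra.algebraMap_mem _ _)
    have h2 := aeval_derivative_mem_differentIdeal (𝓞 K) K L (1 : 𝓞 L) h1
    have h3 : minpoly (𝓞 K) (1 : 𝓞 L) = X - C 1 := by
      have := minpoly.eq_X_sub_C_of_algebraMap_inj (B := 𝓞 L) (1 : 𝓞 K) (FaithfulSMul.algebraMap_injective _ _)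
      rwa [map_one] at this
    rw [h3] at h2
    simp only [derivative_C, derivative_sub, derivative_X, derivative_one, sub_zero, map_one] at h2
    rw [(Ideal.eq_top_iff_one _).mpr h2, Ideal.relNorm_top, Ideal.span_singleton_eq_top.mpr hu]
  have hex : ∀ t : K, t ^ 2 ≠ d := fun t ht => hex ⟨t, ht⟩
  have hirr : Irreducible (X ^ 2 - C (d : K)) :=
    X_pow_sub_C_irreducible_of_prime Nat.prime_two hex
  have hmin : minpoly K s = X ^ 2 - C (d : K) :=
    (minpoly.eq_of_irreducible_of_monic hirr (by simp [hs]) (by monicity!)).symm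
  have hsK : IsIntegral K s := Algebra.IsIntegral.isIntegral s
  let pb := PowerBasis.ofAdjoinEqTop hsK hL
  have hgen : pb.gen = s := by simp [pb]
  have hdim : pb.dim = 2 := by
    rw [← pb.natDegree_minpoly, hgen, hmin]; compute_degree!
  have htr : Algebra.trace K L s = 0 := by
    have := pb.trace_gen_eq_nextCoeff_minpoly
    rw [hgen, hmin] at this
    rw [this, nextCoeff_of_natDegree_pos (by rw [natDegree_X_pow_sub_C]; norm_num),
      natDegree_X_pow_sub_C]
    simp [coeff_C, coeff_X_pow, -map_intCast, -eq_intCast]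
  have hno : Algebra.norm K s = -d := by
    have := Algebra.PowerBasis.norm_gen_eq_coeff_zero_minpoly pb
    rw [hgen, hmin, hdim] at this
    rw [this]; simp
  have hfr : Module.finrank K L = 2 := by rw [pb.finrank, hdim]
  have hexp : ∀ x : L, ∃ a b : K, x = algebraMap K L a + algebraMap K L b * s := by
    intro x
    let B := pb.basis.reindex (finCongr hdim)
    refine ⟨B.repr x 0, B.repr x 1, ?_⟩
    conv_lhs => rw [← B.sum_repr x]
    simp [Fin.sum_univ_two, B, hgen, Algebra.smul_def]
  obtain ⟨m, hm⟩ : ∃ m, d = 1 + 4 * m := ⟨d / 4, by omega⟩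
  have hmL : (d : L) = 1 + 4 * m := by rw [hm]; push_cast; rfl
  have hmK : (d : K) = 1 + 4 * m := by rw [hm]; push_cast; rfl
  have hrel : ((1 + s) / 2) ^ 2 - (1 + s) / 2 - m = 0 := by
    linear_combination (1/4) * hs + (1/4) * hmL
  have hαi : IsIntegral ℤ ((1 + s) / 2) := by
    refine ⟨X ^ 2 - X - C m, by monicity!, ?_⟩
    simpa [-map_intCast, -eq_intCast, eval₂_C] using hrel
  obtain ⟨α, hα⟩ : ∃ α : 𝓞 L, algebraMap (𝓞 L) L α = (1 + s) / 2 := lift_int hαi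
  have hadj : Algebra.adjoin K {algebraMap (𝓞 L) L α} = ⊤ := by
    rw [eq_top_iff, ← hL]
    refine Algebra.adjoin_le ?_
    intro u hu'
    rw [Set.mem_singleton_iff.mp hu']
    have h := Algebra.self_mem_adjoin_singleton K (algebraMap (𝓞 L) L α)
    have : s = algebraMap (𝓞 L) L α + algebraMap (𝓞 L) L α - 1 := by
      rw [hα]; ring
    rw [SetLike.mem_coe]
    generalize Algebra.adjoin K {algebraMap (𝓞 L) L α} = S at h
    rw [this]
    exact sub_mem (add_mem h h) (one_mem _)
  have hminα : minpoly (𝓞 K) α = X ^ 2 - X - C (m : 𝓞 K) := by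
    have hαint : IsIntegral (𝓞 K) α := Algebra.IsIntegral.isIntegral α
    have e1 : minpoly K (algebraMap (𝓞 L) L α) = X ^ 2 - X - C (m : K) := by
      symm
      refine minpoly.eq_of_irreducible_of_monic ?_ ?_ (by monicity!)
      · refine irreducible_of_degree_le_three_of_not_isRoot ?_ ?_
        · have : (X ^ 2 - X - C (m : K)).natDegree = 2 := by compute_degree!
          rw [this]; simp
        · intro x hx
          simp only [IsRoot, eval_sub, eval_pow, eval_X, eval_C] at hx
          exact hex (2 * x - 1) (by rw [hmK]; linear_combination 4 * hx)
      · rw [hα]; simpa using hrel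
    rw [minpoly.isIntegrallyClosed_eq_field_fractions K L hαint] at e1
    apply map_injective _ (RingOfIntegers.coe_injective (K := K))
    rw [e1]; simp
  have htop : Algebra.adjoin (𝓞 K) {α} = ⊤ := by
    rw [eq_top_iff]
    rintro x -
    obtain ⟨a, b, hab⟩ := hexp (algebraMap (𝓞 L) L x)
    have hxint : IsIntegral ℤ (algebraMap (𝓞 L) L x) := x.2
    have t1 : Algebra.trace K L (algebraMap (𝓞 L) L x) = 2 * a := by
      rw [hab, map_add, Algebra.trace_algebraMap, ← Algebra.smul_def, map_smul, htr, hfr]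
      simp
    have t2 : Algebra.trace K L ((algebraMap (𝓞 L) L x) ^ 2) = 2 * (a ^ 2 + b ^ 2 * d) := by
      have : (algebraMap (𝓞 L) L x) ^ 2 = algebraMap K L (a ^ 2 + b ^ 2 * d) + algebraMap K L (2 * a * b) * s := by
        rw [hab]; simp only [map_add, map_mul, map_pow, map_intCast, map_ofNat]
        linear_combination (algebraMap K L b) ^ 2 * hs
      rw [this, map_add, Algebra.trace_algebraMap, ← Algebra.smul_def, map_smul, htr, hfr]
      simp [mul_add]
    have i1 : IsIntegral ℤ (2 * a) := t1 ▸ Algebra.isIntegral_trace hxint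
    have i2 : IsIntegral ℤ (2 * (a ^ 2 + b ^ 2 * d)) := t2 ▸ Algebra.isIntegral_trace (hxint.pow 2)
    have idd : IsIntegral ℤ (d : K) := isIntegral_algebraMap (R := ℤ) (x := d)
    have i3 : IsIntegral ℤ ((2 * b) ^ 2 * d) := by
      have : (2 * b) ^ 2 * d = (2 * (a ^ 2 + b ^ 2 * d)) + (2 * (a ^ 2 + b ^ 2 * d)) - (2 * a) ^ 2 := by
        ring
      rw [this]; exact (i2.add i2).sub (i1.pow 2)
    have i4 : IsIntegral ℤ (2 * b * d) := by
      refine IsIntegral.of_pow (n := 2) (by norm_num) ?_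
      have : (2 * b * d) ^ 2 = (2 * b) ^ 2 * d * d := by ring
      rw [this]; exact i3.mul idd
    obtain ⟨u, hu⟩ := lift_int i3
    obtain ⟨v, hv⟩ := lift_int i4
    obtain ⟨β, hβ⟩ := hrad v ⟨u, by
      apply ext_int
      rw [map_mul, map_pow, map_intCast, hu, hv]; ring⟩
    have hβ' : algebraMap (𝓞 K) K β = 2 * b := by
      have := congrArg (algebraMap (𝓞 K) K) hβ
      rw [hv, map_mul, map_intCast] at this
      exact mul_left_cancel₀ hd0K (by linear_combination -this)
    -- x = γ + β α, γ = a - b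
    have hγ : IsIntegral ℤ (a - b) := by
      have h : IsIntegral ℤ (algebraMap K L (a - b)) := by
        have : algebraMap K L (a - b) = (algebraMap (𝓞 L) L x) - (algebraMap (𝓞 L) L (algebraMap (𝓞 K) (𝓞 L) β * α)) := by
          rw [map_mul, ← IsScalarTower.algebraMap_apply, IsScalarTower.algebraMap_apply (𝓞 K) K L,
            hβ', hα, hab]
          simp only [map_sub, map_mul, map_ofNat]; ring
        rw [this]; exact hxint.sub (RingOfIntegers.isIntegral_coe _)
      exact (isIntegral_algebraMap_iff (algebraMap K L).injective).mp h
    obtain ⟨γ, hγ⟩ := lift_int hγ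
    have hx : x = algebraMap (𝓞 K) (𝓞 L) γ + algebraMap (𝓞 K) (𝓞 L) β * α := by
      apply ext_int
      rw [map_add, map_mul, ← IsScalarTower.algebraMap_apply, ← IsScalarTower.algebraMap_apply,
        IsScalarTower.algebraMap_apply (𝓞 K) K L, IsScalarTower.algebraMap_apply (𝓞 K) K L β,
            hβ', hα, hab, hγ]
      simp only [map_sub, map_mul, map_ofNat]; ring
    rw [hx]
    exact add_mem (Subalgebra.algebraMap_mem _ _)
      (mul_mem (Subalgebra.algebraMap_mem _ _) (Algebra.self_mem_adjoin_singleton _ _))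
  have hc := conductor_mul_differentIdeal (𝓞 K) K L α hadj
  rw [conductor_eq_top_of_adjoin_eq_top htop, ← Ideal.one_eq_top, one_mul, hminα] at hc
  rw [hc, Ideal.relNorm_singleton]
  have hn : Algebra.intNorm (𝓞 K) (𝓞 L) (aeval α (derivative (X ^ 2 - X - C (m : 𝓞 K)))) = -d := by
    apply ext_int
    rw [Algebra.algebraMap_intNorm (A := 𝓞 K) (K := K) (L := L) (B := 𝓞 L)]
    have : algebraMap (𝓞 L) L (aeval α (derivative (X ^ 2 - X - C (m : 𝓞 K)))) = s := by
      simp [hα]; ring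
    rw [this, hno]; simp
  rw [hn, Ideal.span_singleton_neg]
end

section
/- Let $d$ be an odd square-free integer with $d \equiv 1 \pmod 4$. Then the ring of integers of $L_d = \mathbb{Q}(\zeta_8, \sqrt{d})$ is $\mathbb{Z}[\zeta_8, \frac{1+\sqrt{d}}{2}]$. -/
open NumberField

lemma aux_integral_mem {L : Type} [Field L] [NumberField L] (ζ : L) (hζ : IsPrimitiveRoot ζ 8)
    (z : L) (hz : z ∈ IntermediateField.adjoin ℚ {ζ}) (hi : IsIntegral ℤ z) :
    z ∈ Algebra.adjoin ℤ {ζ} := by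
  have hcyc : IsCyclotomicExtension {8} ℚ (IntermediateField.adjoin ℚ {ζ}) :=
    hζ.intermediateField_adjoin_isCyclotomicExtension ℚ
  let ζ' : IntermediateField.adjoin ℚ {ζ} := ⟨ζ, IntermediateField.mem_adjoin_simple_self ℚ ζ⟩
  have hζ' : IsPrimitiveRoot ζ' 8 := by
    refine IsPrimitiveRoot.of_map_of_injective
      (f := (IntermediateField.adjoin ℚ {ζ}).val) ?_ (RingHom.injective _)
    exact hζ
  have h := IsCyclotomicExtension.Rat.isIntegralClosure_adjoin_singleton (n := 8) hζ'
  let z' : IntermediateField.adjoin ℚ {ζ} := ⟨z, hz⟩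
  have hz' : IsIntegral ℤ z' := by
    rw [← isIntegral_algHom_iff ((IntermediateField.adjoin ℚ {ζ}).val.restrictScalars ℤ)
      (RingHom.injective _)]
    exact hi
  obtain ⟨y, hy⟩ := h.isIntegral_iff.1 hz'
  have h1 : z' ∈ Algebra.adjoin ℤ {ζ'} := by rw [← hy]; exact y.2
  have h2 : z ∈ (Algebra.adjoin ℤ {ζ'}).map
      ((IntermediateField.adjoin ℚ {ζ}).val.restrictScalars ℤ) :=
    Subalgebra.mem_map.2 ⟨z', h1, rfl⟩
  rw [AlgHom.map_adjoin, Set.image_singleton] at h2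
  exact h2

lemma aux_frob {L : Type} [Field L] (ζ : L) (hζ : ζ ^ 8 = 1) (p : ℕ) (hp : p.Prime)
    (hodd : Odd p) (c : L) (hc : c ∈ Algebra.adjoin ℤ {ζ}) :
    ∃ e ∈ Algebra.adjoin ℤ {ζ}, c ^ (p ^ 2) = c + p * e := by
  have : Fact p.Prime := ⟨hp⟩
  induction hc using Algebra.adjoin_induction with
  | mem x hx =>
    obtain rfl := hx
    refine ⟨0, zero_mem _, ?_⟩
    have : p ^ 2 % 8 = 1 := by
      have h1 : p % 8 = 1 ∨ p % 8 = 3 ∨ p % 8 = 5 ∨ p % 8 = 7 := by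
        obtain ⟨k, rfl⟩ := hodd; omega
      rcases h1 with h | h | h | h <;> simp [Nat.pow_mod, h]
    rw [← Nat.div_add_mod (p ^ 2) 8, this, pow_add, pow_mul, hζ]; simp
  | algebraMap r =>
    have h : (p : ℤ) ∣ r ^ (p ^ 2) - r := by
      rw [← ZMod.intCast_zmod_eq_zero_iff_dvd]
      push_cast
      rw [ZMod.pow_card_pow, sub_self]
    obtain ⟨k, hk⟩ := h
    refine ⟨algebraMap ℤ L k, Subalgebra.algebraMap_mem _ _, ?_⟩
    have := congrArg (fun t : ℤ => (t : L)) hk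
    push_cast at this
    simp only [eq_intCast]
    linear_combination this
  | add x y hx hy ihx ihy =>
    obtain ⟨e, he, h1⟩ := ihx
    obtain ⟨f, hf, h2⟩ := ihy
    obtain ⟨r, hr⟩ := exists_add_pow_prime_pow_eq hp
      (⟨x, hx⟩ : Algebra.adjoin ℤ {ζ}) ⟨y, hy⟩ 2
    have := congrArg (Subtype.val) hr
    push_cast at this
    refine ⟨e + f + x * y * r, ?_, ?_⟩
    · exact add_mem (add_mem he hf) (mul_mem (mul_mem hx hy) r.2)
    · rw [this, h1, h2]; ring
  | mul x y hx hy ihx ihy =>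
    obtain ⟨e, he, h1⟩ := ihx
    obtain ⟨f, hf, h2⟩ := ihy
    refine ⟨x * f + e * y + p * (e * f), ?_, ?_⟩
    · exact add_mem (add_mem (mul_mem hx hf) (mul_mem he hy))
        (mul_mem (natCast_mem _ p) (mul_mem he hf))
    · rw [mul_pow, h1, h2]; ring

lemma aux_sq {L : Type} [Field L] (ζ : L) (hζ : ζ ^ 8 = 1) (n : ℕ) :
    Squarefree n → Odd n → ∀ c ∈ Algebra.adjoin ℤ {ζ}, ∀ e ∈ Algebra.adjoin ℤ {ζ},
    c ^ 2 = n * e → ∃ f ∈ Algebra.adjoin ℤ {ζ}, c = n * f := by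
  induction n using induction_on_primes with
  | zero => intro h; simp at h
  | one => intro _ _ c hc e _ _; exact ⟨c, hc, by simp⟩
  | prime_mul p m hp ih =>
    intro hsq hodd c hc e he h
    obtain ⟨hcop, -, hm⟩ := Nat.squarefree_mul_iff.1 hsq
    obtain ⟨hop, hom⟩ := Nat.odd_mul.1 hodd
    push_cast at h
    obtain ⟨g, hg, hcg⟩ := ih hm hom c hc (p * e) (mul_mem (natCast_mem _ p) he)
      (by rw [h]; ring)
    obtain ⟨k, hk, hck⟩ := aux_frob ζ hζ p hp hop c hc
    have h2 : 2 ≤ p ^ 2 := by nlinarith [hp.two_le]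
    obtain ⟨j, hj⟩ := Nat.exists_eq_add_of_le h2
    rw [hj, pow_add, h] at hck
    have hcf : c = p * (m * e * c ^ j - k) := by linear_combination -hck
    set f := m * e * c ^ j - k with hf
    have hfm : f ∈ Algebra.adjoin ℤ {ζ} :=
      sub_mem (mul_mem (mul_mem (natCast_mem _ m) he) (pow_mem hc j)) hk
    obtain ⟨u, v, huv⟩ := Nat.isCoprime_iff_coprime.2 hcop
    refine ⟨u * g + v * f, add_mem (mul_mem (intCast_mem _ u) hg) (mul_mem (intCast_mem _ v) hfm), ?_⟩
    have := congrArg (fun t : ℤ => (t : L)) huv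
    push_cast at this ⊢
    linear_combination (-c) * this + u * p * hcg + v * m * hcf

theorem stmt_1 (d : ℤ) (hodd : Odd d) (hd : Squarefree d) (hd4 : d % 4 = 1)
    (L : Type) [Field L] [NumberField L]
    (ζ : L) (hζ : IsPrimitiveRoot ζ 8) (s : L) (hs : s ^ 2 = (d : L))
    (hgen : Algebra.adjoin ℚ {ζ, s} = ⊤) :
    Algebra.adjoin ℤ {ζ, (1 + s) / 2} = integralClosure ℤ L := by
  have hζ8 : ζ ^ 8 = 1 := hζ.pow_eq_one
  have hζi : IsIntegral ℤ ζ := hζ.isIntegral (by norm_num)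
  have hθi : IsIntegral ℤ ((1 + s) / 2) := by
    obtain ⟨k, hk⟩ : ∃ k, d = 4 * k + 1 := ⟨d / 4, by omega⟩
    have h1 : ((1 + s) / 2) * ((1 + s) / 2 - 1) = (k : L) := by
      have : (d : L) = 4 * k + 1 := by rw [hk]; push_cast; ring
      linear_combination (1 / 4) * hs + (1 / 4) * this
    refine ⟨Polynomial.X ^ 2 - Polynomial.X - Polynomial.C k, ?_, ?_⟩
    · monicity!
    · simp only [Polynomial.eval₂_sub, Polynomial.eval₂_pow, Polynomial.eval₂_X,
        Polynomial.eval₂_C]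
      rw [eq_intCast (algebraMap ℤ L) k]
      linear_combination h1
  have hsi : IsIntegral ℤ s := by
    refine IsIntegral.of_pow (n := 2) (by norm_num) ?_
    rw [hs]; exact isIntegral_algebraMap (R := ℤ) (x := d)
  have hle : Algebra.adjoin ℤ {ζ} ≤ Algebra.adjoin ℤ {ζ, (1 + s) / 2} :=
    Algebra.adjoin_mono (by simp)
  apply le_antisymm
  · apply Algebra.adjoin_le
    rintro x (rfl | rfl)
    · exact hζi
    · exact hθi
  intro α hα
  have hα : IsIntegral ℤ α := hα
  set K := IntermediateField.adjoin ℚ {ζ} with hK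
  have hζK : ζ ∈ K := IntermediateField.mem_adjoin_simple_self ℚ ζ
  have hdec : ∀ β : L, ∃ x ∈ K, ∃ y ∈ K, β = x + y * s := by
    intro β
    have hβ : β ∈ Algebra.adjoin ℚ {ζ, s} := by rw [hgen]; trivial
    induction hβ using Algebra.adjoin_induction with
    | mem x hx =>
      rcases hx with rfl | rfl
      · exact ⟨x, hζK, 0, zero_mem _, by simp⟩
      · exact ⟨0, zero_mem _, 1, one_mem _, by simp⟩
    | algebraMap r => exact ⟨_, K.algebraMap_mem r, 0, zero_mem _, by simp⟩
    | add x y _ _ ihx ihy =>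
      obtain ⟨a, ha, b, hb, rfl⟩ := ihx
      obtain ⟨a', ha', b', hb', rfl⟩ := ihy
      exact ⟨a + a', add_mem ha ha', b + b', add_mem hb hb', by ring⟩
    | mul x y _ _ ihx ihy =>
      obtain ⟨a, ha, b, hb, rfl⟩ := ihx
      obtain ⟨a', ha', b', hb', rfl⟩ := ihy
      exact ⟨a * a' + b * b' * d, add_mem (mul_mem ha ha') (mul_mem (mul_mem hb hb') (intCast_mem _ d)),
        a * b' + b * a', add_mem (mul_mem ha hb') (mul_mem hb ha'),
        by linear_combination b * b' * hs⟩
  obtain ⟨x, hx, y, hy, hxy⟩ := hdec α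
  by_cases hsK : s ∈ K
  · apply hle
    apply aux_integral_mem ζ hζ α _ hα
    rw [hxy]; exact add_mem hx (mul_mem hy hsK)
  -- the conjugate is integral
  have hconj : ∀ f : Polynomial ℤ, ∃ P ∈ K, ∃ Q ∈ K,
      Polynomial.aeval (x + y * s) f = P + Q * s ∧ Polynomial.aeval (x - y * s) f = P - Q * s := by
    intro f
    induction f using Polynomial.induction_on' with
    | add f g ihf ihg =>
      obtain ⟨a, ha, b, hb, h1, h2⟩ := ihf
      obtain ⟨a', ha', b', hb', h3, h4⟩ := ihg
      refine ⟨a + a', add_mem ha ha', b + b', add_mem hb hb', ?_, ?_⟩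
      · rw [map_add, h1, h3]; ring
      · rw [map_add, h2, h4]; ring
    | monomial n r =>
      induction n with
      | zero => exact ⟨r, intCast_mem _ r, 0, zero_mem _, by simp, by simp⟩
      | succ n ih =>
        obtain ⟨a, ha, b, hb, h1, h2⟩ := ih
        refine ⟨a * x + b * y * d, add_mem (mul_mem ha hx) (mul_mem (mul_mem hb hy) (intCast_mem _ d)),
          a * y + b * x, add_mem (mul_mem ha hy) (mul_mem hb hx), ?_, ?_⟩
        · rw [← Polynomial.monomial_mul_X, map_mul, h1, Polynomial.aeval_X]
          linear_combination b * y * hs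
        · rw [← Polynomial.monomial_mul_X, map_mul, h2, Polynomial.aeval_X]
          linear_combination b * y * hs
  have hα' : IsIntegral ℤ (x - y * s) := by
    obtain ⟨f, hf, hf0⟩ := hα
    obtain ⟨P, hP, Q, hQ, h1, h2⟩ := hconj f
    refine ⟨f, hf, ?_⟩
    rw [← Polynomial.aeval_def] at hf0 ⊢
    rw [← hxy, hf0] at h1
    have hQ0 : Q = 0 := by
      by_contra hne
      apply hsK
      have : s = -P / Q := by field_simp; linear_combination -h1
      rw [this]; exact div_mem (neg_mem hP) hQ
    have hP0 : P = 0 := by rw [hQ0] at h1; simpa using h1.symm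
    rw [h2, hP0, hQ0]; simp
  have hbs : IsIntegral ℤ (2 * y * s) := by
    have := hα.sub hα'
    rw [hxy] at this
    have h3 : 2 * y * s = x + y * s - (x - y * s) := by ring
    rw [h3]; exact this
  set b := 2 * y with hb
  have hbK : b ∈ K := mul_mem (ofNat_mem K 2) hy
  have he : d * b ^ 2 ∈ Algebra.adjoin ℤ {ζ} := by
    apply aux_integral_mem ζ hζ _ (mul_mem (intCast_mem _ d) (pow_mem hbK 2))
    have h3 : d * b ^ 2 = (b * s) ^ 2 := by linear_combination (-b ^ 2) * hs
    rw [h3]; exact hbs.pow 2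
  have hc : d * b ∈ Algebra.adjoin ℤ {ζ} := by
    apply aux_integral_mem ζ hζ _ (mul_mem (intCast_mem _ d) hbK)
    have h3 : d * b = b * s * s := by linear_combination (-b) * hs
    rw [h3]; exact hbs.mul hsi
  have hd0 : (d : L) ≠ 0 := by exact_mod_cast hd.ne_zero
  have hbA : b ∈ Algebra.adjoin ℤ {ζ} := by
    have hsqf : Squarefree d.natAbs := Int.squarefree_natAbs.2 hd
    have hoddn : Odd d.natAbs := Int.natAbs_odd.2 hodd
    rcases Int.natAbs_eq d with h | h
    · have h' : (d : L) = (d.natAbs : L) := by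
        conv_lhs => rw [h]
        simp
      obtain ⟨f, hf, hf'⟩ := aux_sq ζ hζ8 d.natAbs hsqf hoddn _ hc _ he
        (by rw [← h']; ring)
      rw [← h'] at hf'
      rw [mul_left_cancel₀ hd0 hf']; exact hf
    · have h' : (d.natAbs : L) = -(d : L) := by
        conv_rhs => rw [h]
        simp
      obtain ⟨f, hf, hf'⟩ := aux_sq ζ hζ8 d.natAbs hsqf hoddn _ hc _ (neg_mem he)
        (by rw [h']; ring)
      have : b = -f := mul_left_cancel₀ hd0 (by rw [hf', h']; ring)
      rw [this]; exact neg_mem hf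
  have hbi : IsIntegral ℤ b := adjoin_le_integralClosure hζi hbA
  have haA : x - y ∈ Algebra.adjoin ℤ {ζ} := by
    apply aux_integral_mem ζ hζ _ (sub_mem hx hy)
    have h3 : x - y = α - b * ((1 + s) / 2) := by rw [hxy, hb]; ring
    rw [h3]; exact hα.sub (hbi.mul hθi)
  have : α = (x - y) + b * ((1 + s) / 2) := by rw [hxy, hb]; ring
  rw [this]
  exact add_mem (hle haA) (mul_mem (hle hbA) (Algebra.subset_adjoin (by simp)))
end

section
/- Let $d$ be an odd positive square-free integer with exactly $r$ distinct prime factors, of which exactly $q$ are congruent to $1 \pmod 8$. Then the number of prime ideals of $K = \mathbb{Q}(\zeta_8)$ that ramify in $L_d = K(\sqrt{d})$ equals $2(q+r)$. -/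
open NumberField

open Polynomial in
lemma aux_unram (K L : Type) [Field K] [NumberField K] [Field L] [NumberField L] [Algebra K L]
    (t : L) (c : ℤ) (ht : t ^ 2 = 4 * (c : L) + 1) (hL : Algebra.adjoin K {t} = ⊤)
    (P : Ideal (𝓞 K)) (hP : P.IsPrime) (hP0 : P ≠ ⊥) (Q : Ideal (𝓞 L)) (hQ : Q.IsPrime)
    (h : Ideal.map (algebraMap (𝓞 K) (𝓞 L)) P ≤ Q ^ 2) : ((4 * c + 1 : ℤ) : 𝓞 K) ∈ P := by
  have hα0 : ((1 + t) / 2) ^ 2 - (1 + t) / 2 - (c : L) = 0 := by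
    linear_combination ht / 4
  have hint : IsIntegral ℤ ((1 + t) / 2) := by
    refine ⟨X ^ 2 - X - C c, by monicity!, ?_⟩
    simpa [-eq_intCast, -map_intCast, eval₂_sub] using hα0
  let α : 𝓞 L := ⟨(1 + t) / 2, hint⟩
  have hαc : algebraMap (𝓞 L) L α = (1 + t) / 2 := rfl
  have hα : α ^ 2 - α - (c : 𝓞 L) = 0 := by
    apply RingOfIntegers.coe_injective
    simpa [hαc] using hα0
  have hadj : Algebra.adjoin K {algebraMap (𝓞 L) L α} = ⊤ := by
    rw [eq_top_iff, ← hL]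
    apply Algebra.adjoin_le
    rw [Set.singleton_subset_iff]
    have h1 := Algebra.self_mem_adjoin_singleton K (algebraMap (𝓞 L) L α)
    have : t = algebraMap (𝓞 L) L α + algebraMap (𝓞 L) L α - 1 := by rw [hαc]; ring
    rw [SetLike.mem_coe]
    nth_rw 1 [this]
    exact sub_mem (add_mem h1 h1) (one_mem _)
  have hmax : P.IsMaximal := hP.isMaximal hP0
  have hdiff := aeval_derivative_mem_differentIdeal (𝓞 K) K L α hadj
  have hdvd := pow_sub_one_dvd_differentIdeal_aux (𝓞 K) K L Q two_ne_zero hP0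
    (Ideal.dvd_iff_le.mpr h)
  have hQm := (Ideal.dvd_iff_le.mp hdvd) hdiff
  simp only [Nat.add_one_sub_one, pow_one] at hQm
  have hαK : IsIntegral (𝓞 K) α := Algebra.IsIntegral.isIntegral α
  obtain ⟨g, hg⟩ := minpoly.isIntegrallyClosed_dvd hαK
    (p := (X ^ 2 - X - C (c : 𝓞 K))) (by simpa using hα)
  have hder := congrArg (fun f => aeval α (derivative f)) hg
  simp [minpoly.aeval] at hder
  have hs : 2 * α - 1 ∈ Q := by
    rw [show 2 * α - 1 = (1 + 1) * α - 1 by ring, hder]; exact Ideal.mul_mem_right _ _ hQm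
  have hs2 : ((4 * c + 1 : ℤ) : 𝓞 L) ∈ Q := by
    have : ((4 * c + 1 : ℤ) : 𝓞 L) = (2 * α - 1) * (2 * α - 1) := by
      push_cast; linear_combination -4 * hα
    rw [this]; exact Ideal.mul_mem_left _ _ hs
  have hle : P ≤ Q.comap (algebraMap (𝓞 K) (𝓞 L)) :=
    Ideal.map_le_iff_le_comap.mp (h.trans (Ideal.pow_le_self two_ne_zero))
  have := hmax.eq_of_le (Ideal.comap_isPrime _ Q).ne_top hle
  rw [this, Ideal.mem_comap, map_intCast]
  exact hs2

lemma aux_cyc (K : Type) [Field K] [NumberField K] 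
    (ζ : K) (hζ : IsPrimitiveRoot ζ 8) (hK : Algebra.adjoin ℚ {ζ} = ⊤) :
    IsCyclotomicExtension {8} ℚ K := by
  rw [IsCyclotomicExtension.iff_adjoin_eq_top]
  refine ⟨?_, ?_⟩
  · rintro n hn -
    rw [Set.mem_singleton_iff] at hn; subst hn
    exact ⟨ζ, hζ⟩
  · rw [eq_top_iff, ← hK]
    apply Algebra.adjoin_mono
    rintro _ rfl
    exact ⟨8, rfl, by norm_num, hζ.pow_eq_one⟩

lemma aux_order (p : ℕ) (h : p % 2 = 1) : orderOf (p : ZMod 8) = if p % 8 = 1 then 1 else 2 := by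
  have : p % 8 = 1 ∨ p % 8 = 3 ∨ p % 8 = 5 ∨ p % 8 = 7 := by omega
  rw [← ZMod.natCast_mod]
  have h1 : ∀ x : ZMod 8, x ^ 2 = 1 → x ≠ 1 → orderOf x = 2 := fun x hx hx1 =>
    orderOf_eq_prime hx hx1
  rcases this with h | h | h | h <;> rw [h]
  · simp
  all_goals
    simp only [OfNat.ofNat_ne_one, if_false]
    exact h1 _ (by decide) (by decide)

lemma aux_count (K : Type) [Field K] [NumberField K] [IsCyclotomicExtension {8} ℚ K]
    (p : ℕ) (hp : p.Prime) (h : p % 2 = 1) :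
    (Ideal.primesOver (Ideal.span {(p : ℤ)}) (𝓞 K)).ncard = if p % 8 = 1 then 4 else 2 := by
  have : Fact p.Prime := ⟨hp⟩
  have hnd : ¬ p ∣ 8 := by
    intro hd
    have := (Nat.prime_dvd_prime_iff_eq hp Nat.prime_two).mp (hp.dvd_of_dvd_pow (show p ∣ 2 ^ 3 from hd))
    omega
  have : IsGalois ℚ K := IsCyclotomicExtension.isGalois {8} ℚ K
  have hprime : (Ideal.span {(p : ℤ)}).IsPrime :=
    (Ideal.span_singleton_prime (by exact_mod_cast hp.ne_zero)).mpr (Nat.prime_iff_prime_int.mp hp)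
  have h1 := Ideal.ncard_primesOver_mul_ramificationIdxIn_mul_inertiaDegIn
    (Ideal.span {(p : ℤ)}) (𝓞 K) Gal(K/ℚ)
  rw [IsCyclotomicExtension.Rat.inertiaDegIn_eq_of_not_dvd p K hnd, IsCyclotomicExtension.Rat.ramificationIdxIn_eq_of_not_dvd p K hnd,
    aux_order p h, IsGalois.card_aut_eq_finrank,
    IsCyclotomicExtension.finrank (n := 8) K (Polynomial.cyclotomic.irreducible_rat (by norm_num)),
    show Nat.totient 8 = 4 by decide] at h1
  split_ifs at h1 ⊢ <;> omega

lemma aux_not_sq (K : Type) [Field K] [NumberField K] [IsCyclotomicExtension {8} ℚ K]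
    (d : ℕ) (hodd : Odd d) (hd : Squarefree d)
    (P : Ideal (𝓞 K)) (hP : P.IsPrime) (hP0 : P ≠ ⊥) (p : ℕ) (hp : p.Prime) (hpd : p ∣ d)
    (hpP : (p : 𝓞 K) ∈ P) : ¬ (P ^ 2 ∣ Ideal.span {(d : 𝓞 K)}) := by
  have : Fact p.Prime := ⟨hp⟩
  have h2 : p % 2 = 1 := Nat.odd_iff.mp (hodd.of_dvd_nat hpd)
  have hnd : ¬ p ∣ 8 := by
    intro hd
    have := (Nat.prime_dvd_prime_iff_eq hp Nat.prime_two).mp (hp.dvd_of_dvd_pow (show p ∣ 2 ^ 3 from hd))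
    omega
  have hpmax : (Ideal.span {(p : ℤ)}).IsMaximal :=
    Int.ideal_span_isMaximal_of_prime p
  have hlies : P.LiesOver (Ideal.span {(p : ℤ)}) := by
    constructor
    apply hpmax.eq_of_le (Ideal.comap_isPrime _ P).ne_top
    rw [Ideal.span_singleton_le_iff_mem]
    simpa [Ideal.under] using hpP
  obtain ⟨m, rfl⟩ := hpd
  have hcop : Nat.Coprime p m := Nat.coprime_of_squarefree_mul hd
  intro hdv
  have hPp : Prime P := Ideal.prime_of_isPrime hP0 hP
  have hmP : ¬ P ∣ Ideal.span {(m : 𝓞 K)} := by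
    intro hm
    rw [Ideal.dvd_span_singleton] at hm
    apply hP.ne_top
    rw [Ideal.eq_top_iff_one]
    have := (Nat.isCoprime_iff_coprime.mpr hcop)
    obtain ⟨a, b, hab⟩ := this
    have h1 : (a : 𝓞 K) * p + b * m = 1 := by exact_mod_cast congrArg (Int.cast : ℤ → 𝓞 K) hab
    rw [← h1]
    exact add_mem (Ideal.mul_mem_left _ _ hpP) (Ideal.mul_mem_left _ _ hm)
  push_cast at hdv
  rw [← Ideal.span_singleton_mul_span_singleton] at hdv
  have h3 := hPp.pow_dvd_of_dvd_mul_right 2 hmP hdv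
  have hr := IsCyclotomicExtension.Rat.ramificationIdx_eq_of_not_dvd p K P hnd
  have hp0 : (Ideal.span {(p : ℤ)}) ≠ ⊥ := by simpa using hp.ne_zero
  have hle : Ideal.map (algebraMap ℤ (𝓞 K)) (Ideal.span {(p : ℤ)}) ≤ P ^ 2 := by
    rw [Ideal.map_span]; simpa using Ideal.dvd_iff_le.mp h3
  rw [← Ideal.ramificationIdx'_eq_ramificationIdx (Ideal.span {(p : ℤ)}) P hp0] at hr
  by_cases hle3 : ∃ n, ∀ k, Ideal.map (algebraMap ℤ (𝓞 K)) (Ideal.span {(p : ℤ)}) ≤ P ^ k → k ≤ n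
  · classical
    rw [Ideal.ramificationIdx'_eq_find hle3] at hr
    have := Nat.find_spec hle3 2 hle
    omega
  · rw [Ideal.ramificationIdx'_eq_zero (by push Not at hle3; exact hle3)] at hr
    omega

lemma aux_ram (K L : Type) [Field K] [NumberField K] [Field L] [NumberField L] [Algebra K L]
    [IsCyclotomicExtension {8} ℚ K]
    (d : ℕ) (hodd : Odd d) (hd : Squarefree d) (s : L) (hs : s ^ 2 = (d : L))
    (P : Ideal (𝓞 K)) (hP : P.IsPrime) (hP0 : P ≠ ⊥) (p : ℕ) (hp : p.Prime) (hpd : p ∣ d)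
    (hpP : (p : 𝓞 K) ∈ P) : ∃ Q : Ideal (𝓞 L), Q.IsPrime ∧
        Ideal.map (algebraMap (𝓞 K) (𝓞 L)) P ≤ Q ^ 2 := by
  have hn := aux_not_sq K d hodd hd P hP hP0 p hp hpd hpP
  have hmax : P.IsMaximal := hP.isMaximal hP0
  have hdP : (d : 𝓞 K) ∈ P := by
    obtain ⟨m, rfl⟩ := hpd
    push_cast; exact Ideal.mul_mem_right _ _ hpP
  obtain ⟨a, ha⟩ := Ideal.dvd_span_singleton.mpr hdP
  have haP : ¬ a ≤ P := by
    intro h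
    apply hn
    rw [ha, pow_two]
    exact mul_dvd_mul_left _ (Ideal.dvd_iff_le.mpr h)
  obtain ⟨⟨Q, hQp, hQP⟩⟩ := P.nonempty_primesOver (S := 𝓞 L)
  refine ⟨Q, hQp, ?_⟩
  have hover : P = Q.comap (algebraMap (𝓞 K) (𝓞 L)) := hQP.over
  have hint : IsIntegral ℤ s := by
    refine IsIntegral.of_pow (n := 2) (by norm_num) ?_
    rw [hs]; exact_mod_cast (isIntegral_algebraMap : IsIntegral ℤ (algebraMap ℤ L (d : ℤ)))
  let σ : 𝓞 L := ⟨s, hint⟩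
  have hσ : σ ^ 2 = (d : 𝓞 L) := by
    apply RingOfIntegers.coe_injective
    have hσc : algebraMap (𝓞 L) L σ = s := rfl
    rw [map_pow, hσc, map_natCast, hs]
  have hdQ : (d : 𝓞 L) ∈ Q := by
    rw [hover, Ideal.mem_comap] at hdP
    simpa using hdP
  have hσQ : σ ∈ Q := hQp.mem_of_pow_mem 2 (hσ ▸ hdQ)
  have hd2 : (d : 𝓞 L) ∈ Q ^ 2 := hσ ▸ Ideal.pow_mem_pow hσQ 2
  have hQ0 : Q ≠ ⊥ := by
    rintro rfl
    have : (d : 𝓞 L) = 0 := by simpa using hdQ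
    have : d = 0 := by exact_mod_cast this
    subst this; simp at hodd
  have hQpr : Prime Q := Ideal.prime_of_isPrime hQ0 hQp
  have hmul : Q ^ 2 ∣ Ideal.map (algebraMap (𝓞 K) (𝓞 L)) P * Ideal.map (algebraMap (𝓞 K) (𝓞 L)) a := by
    rw [← Ideal.map_mul, ← ha, Ideal.map_span]
    simpa [Ideal.dvd_span_singleton] using hd2
  rw [← Ideal.dvd_iff_le]
  refine hQpr.pow_dvd_of_dvd_mul_right 2 ?_ hmul
  rw [Ideal.dvd_iff_le, Ideal.map_le_iff_le_comap, ← hover]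
  exact haP

lemma aux_iff (d : ℕ) (hodd : Odd d) (hd : Squarefree d)
    (K L : Type) [Field K] [NumberField K] [Field L] [NumberField L] [Algebra K L]
    [IsCyclotomicExtension {8} ℚ K]
    (ζ : K) (hζ : IsPrimitiveRoot ζ 8)
    (s : L) (hs : s ^ 2 = (d : L)) (hL : Algebra.adjoin K {s} = ⊤) (P : Ideal (𝓞 K)) :
    (P.IsPrime ∧ P ≠ ⊥ ∧ ∃ Q : Ideal (𝓞 L), Q.IsPrime ∧
        Ideal.map (algebraMap (𝓞 K) (𝓞 L)) P ≤ Q ^ 2) ↔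
    P ∈ ⋃ p ∈ d.primeFactors, Ideal.primesOver (Ideal.span {(p : ℤ)}) (𝓞 K) := by
  have hd0 : d ≠ 0 := by rintro rfl; simp at hodd
  simp only [Set.mem_iUnion, exists_prop]
  constructor
  · rintro ⟨hP, hP0, Q, hQ, h⟩
    have hdP : (d : 𝓞 K) ∈ P := by
      have h4 : d % 4 = 1 ∨ d % 4 = 3 := by
        have := Nat.odd_iff.mp hodd; omega
      rcases h4 with h4 | h4
      · have := aux_unram K L s ((d / 4 : ℕ) : ℤ) ?_ hL P hP hP0 Q hQ h
        · have e : (4 * ((d / 4 : ℕ) : ℤ) + 1) = (d : ℤ) := by omega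
          rw [e] at this
          exact_mod_cast this
        · rw [hs]
          have e : d = 4 * (d / 4) + 1 := by omega
          exact_mod_cast congrArg (Nat.cast : ℕ → L) e
      · have hi : (algebraMap K L (ζ ^ 2)) ^ 2 = -1 := by
          have h8 : (ζ ^ 4) = -1 := by
            have hp : IsPrimitiveRoot (ζ ^ 4) 2 := hζ.pow (by norm_num) (by norm_num)
            exact hp.eq_neg_one_of_two_right
          rw [← map_pow, ← pow_mul, h8]; simp
        have := aux_unram K L (algebraMap K L (ζ ^ 2) * s) (-((d / 4 : ℕ) : ℤ) - 1) ?_ ?_ P hP hP0 Q hQ h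
        · have e : (4 * (-((d / 4 : ℕ) : ℤ) - 1) + 1) = -(d : ℤ) := by omega
          rw [e, Int.cast_neg, neg_mem_iff] at this
          exact_mod_cast this
        · rw [mul_pow, hs, hi]
          have e : (4 * (-((d / 4 : ℕ) : ℤ) - 1) + 1) = -(d : ℤ) := by omega
          have := congrArg (Int.cast : ℤ → L) e
          push_cast at this ⊢
          rw [this]; ring
        · rw [eq_top_iff, ← hL]
          apply Algebra.adjoin_le
          rw [Set.singleton_subset_iff]
          have h1 := Algebra.self_mem_adjoin_singleton K (algebraMap K L (ζ ^ 2) * s)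
          have h2 := neg_mem (Subalgebra.mul_mem _ (Subalgebra.algebraMap_mem
            (Algebra.adjoin K {algebraMap K L (ζ ^ 2) * s}) (ζ ^ 2)) h1)
          have e : -(algebraMap K L (ζ ^ 2) * (algebraMap K L (ζ ^ 2) * s)) = s := by
            linear_combination -s * hi
          rw [e] at h2
          exact h2
    -- some prime factor lies in P
    have : ∃ p ∈ d.primeFactors, (p : 𝓞 K) ∈ P := by
      rw [← Nat.prod_primeFactors_of_squarefree hd, Nat.cast_prod] at hdP
      exact hP.prod_mem_iff.mp hdP
    obtain ⟨p, hp, hpP⟩ := this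
    have hpp := Nat.prime_of_mem_primeFactors hp
    refine ⟨p, hp, hP, ?_⟩
    have : Fact p.Prime := ⟨hpp⟩
    have hpmax : (Ideal.span {(p : ℤ)}).IsMaximal :=
      Int.ideal_span_isMaximal_of_prime p
    constructor
    apply hpmax.eq_of_le (Ideal.comap_isPrime _ P).ne_top
    rw [Ideal.span_singleton_le_iff_mem]
    simpa [Ideal.under] using hpP
  · rintro ⟨p, hp, hP, hl⟩
    have hpp := Nat.prime_of_mem_primeFactors hp
    have hpP : (p : 𝓞 K) ∈ P := by
      have : (p : ℤ) ∈ P.under ℤ := hl.over ▸ Ideal.mem_span_singleton_self _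
      simpa [Ideal.under] using this
    have hP0 : P ≠ ⊥ := by
      rintro rfl
      have : (p : 𝓞 K) = 0 := by simpa using hpP
      exact hpp.ne_zero (by exact_mod_cast this)
    exact ⟨hP, hP0, aux_ram K L d hodd hd s hs P hP hP0 p hpp (Nat.dvd_of_mem_primeFactors hp) hpP⟩

theorem stmt_5 (d : ℕ) (hodd : Odd d) (hpos : 0 < d) (hd : Squarefree d)
    (r q : ℕ) (hr : d.primeFactors.card = r)
    (hq : (d.primeFactors.filter (fun p => p % 8 = 1)).card = q)
    (K L : Type) [Field K] [NumberField K] [Field L] [NumberField L] [Algebra K L]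
    (ζ : K) (hζ : IsPrimitiveRoot ζ 8) (hK : Algebra.adjoin ℚ {ζ} = ⊤)
    (s : L) (hs : s ^ 2 = (d : L)) (hL : Algebra.adjoin K {s} = ⊤) :
    Nat.card {P : Ideal (𝓞 K) // P.IsPrime ∧ P ≠ ⊥ ∧
      ∃ Q : Ideal (𝓞 L), Q.IsPrime ∧
        Ideal.map (algebraMap (𝓞 K) (𝓞 L)) P ≤ Q ^ 2} = 2 * (q + r) := by
  have hcyc := aux_cyc K ζ hζ hK
  have hodd' : ∀ p ∈ d.primeFactors, p % 2 = 1 := fun p hp =>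
    Nat.odd_iff.mp (hodd.of_dvd_nat (Nat.dvd_of_mem_primeFactors hp))
  have hcount := fun p (hp : p ∈ d.primeFactors) =>
    aux_count K p (Nat.prime_of_mem_primeFactors hp) (hodd' p hp)
  have hfin : ∀ p ∈ d.primeFactors, (Ideal.primesOver (Ideal.span {(p : ℤ)}) (𝓞 K)).Finite := by
    intro p hp
    apply Set.finite_of_ncard_ne_zero
    rw [hcount p hp]; split_ifs <;> norm_num
  rw [Nat.card_congr (Equiv.subtypeEquivRight (aux_iff d hodd hd K L ζ hζ s hs hL))]
  change (⋃ p ∈ d.primeFactors, Ideal.primesOver (Ideal.span {(p : ℤ)}) (𝓞 K)).ncard = _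
  have hsum : (⋃ p ∈ d.primeFactors, Ideal.primesOver (Ideal.span {(p : ℤ)}) (𝓞 K)).ncard
      = ∑ p ∈ d.primeFactors, (Ideal.primesOver (Ideal.span {(p : ℤ)}) (𝓞 K)).ncard := by
    classical
    have e : (⋃ p ∈ d.primeFactors, Ideal.primesOver (Ideal.span {(p : ℤ)}) (𝓞 K)) =
      ((d.primeFactors.attach.biUnion (fun p => (hfin p.1 p.2).toFinset) : Finset _) : Set _) := by
      ext; simp
    rw [e, Set.ncard_coe_finset, Finset.card_biUnion]
    · rw [← Finset.sum_attach d.primeFactors]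
      refine Finset.sum_congr rfl fun p _ => ?_
      rw [Set.ncard_eq_toFinset_card _ (hfin p.1 p.2)]
    · rintro ⟨p, hp⟩ - ⟨p', hp'⟩ - hne
      rw [Function.onFun, Finset.disjoint_left]
      intro P h1 h2
      simp only [Set.Finite.mem_toFinset] at h1 h2
      apply hne
      have := h1.2.over.trans h2.2.over.symm
      rw [Ideal.span_singleton_eq_span_singleton, Int.associated_iff_natAbs] at this
      simpa using this
  rw [hsum, Finset.sum_congr rfl hcount]
  have : ∀ p, (if p % 8 = 1 then 4 else 2) = 2 * (if p % 8 = 1 then 1 else 0) + 2 := by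
    intro p; split_ifs <;> rfl
  simp only [this]
  rw [Finset.sum_add_distrib, ← Finset.mul_sum, ← Finset.card_filter, hq, Finset.sum_const, hr]
  simp; ring
end

section
/- Let $d$ be an odd square-free integer. Then the $2$-class group of $L_d = \mathbb{Q}(\zeta_8, \sqrt{d})$ is nontrivial (i.e., $2 \mid h(L_d)$) whenever $|d|$ is composite. -/
theorem aux_thue (p : ℕ) [hp : Fact p.Prime] (s : ZMod p) :
    ∃ a b : ℤ, (a ≠ 0 ∨ b ≠ 0) ∧ a ^ 2 < p ∧ b ^ 2 < p ∧ (a : ZMod p) = s * b := by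
  classical
  set n := Nat.sqrt p with hn
  let D := Finset.range (n + 1) ×ˢ Finset.range (n + 1)
  let f : ℕ × ℕ → ZMod p := fun x => (x.1 : ZMod p) - s * x.2
  have hcard : (Finset.univ : Finset (ZMod p)).card < D.card := by
    simp only [D, Finset.card_product, Finset.card_range, Finset.card_univ, ZMod.card]
    exact Nat.lt_succ_sqrt p
  obtain ⟨x, hx, y, hy, hxy, h⟩ := Finset.exists_ne_map_eq_of_card_lt_of_maps_to hcard
    (f := f) (fun _ _ => Finset.mem_univ _)
  have key : ∀ u v : ℕ, u < n + 1 → v < n + 1 → ((u : ℤ) - v) ^ 2 < p := by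
    intro u v hu hv
    have h1 : ((u : ℤ) - v) ^ 2 ≤ (n : ℤ) ^ 2 := by
      apply sq_le_sq'  <;> omega
    have h2 : n ^ 2 ≤ p := Nat.sqrt_le' p
    have h3 : n ^ 2 ≠ p := by
      intro h
      have := hp.out
      rw [← h] at this
      exact (Nat.Prime.not_prime_pow (le_refl 2)) this
    have h4 : n ^ 2 < p := lt_of_le_of_ne h2 h3
    have : (n : ℤ) ^ 2 < p := by exact_mod_cast h4
    linarith
  simp only [D, Finset.mem_product, Finset.mem_range] at hx hy
  refine ⟨(x.1 : ℤ) - y.1, (x.2 : ℤ) - y.2, ?_, key _ _ hx.1 hy.1, key _ _ hx.2 hy.2, ?_⟩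
  · by_contra hcon
    push Not at hcon
    apply hxy
    ext <;> omega
  · simp only [f] at h
    push_cast
    linear_combination h

theorem aux_not_sq_s12 (c : ℤ) (hc : c = -1 ∨ c = -2 ∨ c = 2) (q : ℚ) : q ^ 2 ≠ c := by
  intro h
  rcases hc with rfl | rfl | rfl
  · push_cast at h; nlinarith [sq_nonneg q]
  · push_cast at h; nlinarith [sq_nonneg q]
  · have : IsSquare ((2 : ℕ) : ℚ) := ⟨q, by push_cast at h ⊢; linarith⟩
    rw [Rat.isSquare_natCast_iff] at this
    exact Nat.prime_two.prime.irreducible.not_isSquare this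

theorem aux_repr (p : ℕ) [hp : Fact p.Prime] (hp2 : p ≠ 2) :
    ∃ c a b : ℤ, (c = -1 ∨ c = -2 ∨ c = 2) ∧ (a ^ 2 - c * b ^ 2 = p ∨ a ^ 2 - c * b ^ 2 = -p) ∧
      IsCoprime (2 * a) (p : ℤ) := by
  have hppos : (0 : ℤ) < p := by exact_mod_cast hp.out.pos
  have hpZ : Prime (p : ℤ) := Nat.prime_iff_prime_int.mp hp.out
  have hodd : p % 2 = 1 := hp.out.eq_two_or_odd.resolve_left hp2
  suffices H : ∃ c a b : ℤ, (c = -1 ∨ c = -2 ∨ c = 2) ∧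
      (a ^ 2 - c * b ^ 2 = p ∨ a ^ 2 - c * b ^ 2 = -p) by
    obtain ⟨c, a, b, hc, h⟩ := H
    refine ⟨c, a, b, hc, h, ?_⟩
    have hp2' : ¬ (p : ℤ) ∣ 2 := by
      intro h
      have : p ∣ 2 := by exact_mod_cast h
      exact hp2 ((Nat.prime_dvd_prime_iff_eq hp.out Nat.prime_two).mp this)
    refine ((Prime.coprime_iff_not_dvd hpZ).mpr ?_).symm
    intro hd
    have ha : (p : ℤ) ∣ a := (hpZ.dvd_or_dvd hd).resolve_left hp2'
    have hcb : (p : ℤ) ∣ c * b ^ 2 := by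
      have h1 : (p : ℤ) ∣ a ^ 2 := dvd_pow ha two_ne_zero
      have h2 : (p : ℤ) ∣ a ^ 2 - c * b ^ 2 := by rcases h with h | h <;> simp [h]
      have := dvd_sub h1 h2
      simpa using this
    have hc' : ¬ (p : ℤ) ∣ c := by
      rcases hc with rfl | rfl | rfl
      · intro h; rw [dvd_neg] at h; exact hpZ.not_dvd_one h
      · rw [dvd_neg]; exact hp2'
      · exact hp2'
    have hb : (p : ℤ) ∣ b := hpZ.dvd_of_dvd_pow ((hpZ.dvd_or_dvd hcb).resolve_left hc')
    have h3 : (p : ℤ) ^ 2 ∣ a ^ 2 - c * b ^ 2 :=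
      dvd_sub (pow_dvd_pow_of_dvd ha 2) (Dvd.dvd.mul_left (pow_dvd_pow_of_dvd hb 2) c)
    have h4 : (p : ℤ) ^ 2 ∣ p := by rcases h with h | h <;> simpa [h] using h3
    have h5 := Int.le_of_dvd hppos h4
    have : (2 : ℤ) ≤ p := by exact_mod_cast hp.out.two_le
    nlinarith
  -- find a square root
  have hs : ∃ c : ℤ, (c = -1 ∨ c = -2 ∨ c = 2) ∧ ∃ s : ZMod p, s ^ 2 = c := by
    have : p % 8 = 1 ∨ p % 8 = 3 ∨ p % 8 = 5 ∨ p % 8 = 7 := by omega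
    rcases this with h | h | h | h
    · obtain ⟨s, hs⟩ := (ZMod.exists_sq_eq_two_iff hp2).mpr (Or.inl h)
      exact ⟨2, by simp, s, by push_cast; rw [hs]; ring⟩
    · obtain ⟨s, hs⟩ := (ZMod.exists_sq_eq_neg_two_iff hp2).mpr (Or.inr h)
      exact ⟨-2, by simp, s, by push_cast; rw [hs]; ring⟩
    · obtain ⟨s, hs⟩ := (ZMod.exists_sq_eq_neg_one_iff (p := p)).mpr (by omega)
      exact ⟨-1, by simp, s, by push_cast; rw [hs]; ring⟩
    · obtain ⟨s, hs⟩ := (ZMod.exists_sq_eq_two_iff hp2).mpr (Or.inr h)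
      exact ⟨2, by simp, s, by push_cast; rw [hs]; ring⟩
  obtain ⟨c, hc, s, hs⟩ := hs
  obtain ⟨a, b, hab, ha, hb, h⟩ := aux_thue p s
  have hdvd : (p : ℤ) ∣ a ^ 2 - c * b ^ 2 := by
    rw [← ZMod.intCast_zmod_eq_zero_iff_dvd]
    push_cast
    rw [h, ← hs]; ring
  obtain ⟨k, hk⟩ := hdvd
  have hne : a ^ 2 - c * b ^ 2 ≠ 0 := by
    intro h0
    by_cases hb0 : b = 0
    · subst hb0
      simp at h0 hab
      exact hab h0
    · apply aux_not_sq_s12 c hc ((a : ℚ) / b)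
      have : (b : ℚ) ≠ 0 := by exact_mod_cast hb0
      field_simp
      have : (a : ℚ) ^ 2 - c * b ^ 2 = 0 := by exact_mod_cast h0
      linarith
  have hk0 : k ≠ 0 := by rintro rfl; simp at hk; exact hne hk
  have hasq := sq_nonneg a
  have hbsq := sq_nonneg b
  rcases hc with rfl | rfl | rfl
  · have h1 : 0 < k := by
      by_contra hcon
      have : k ≤ -1 := by omega
      nlinarith
    have h2 : k < 2 := by nlinarith
    have : k = 1 := by omega
    subst this
    exact ⟨-1, a, b, by simp, Or.inl (by linarith)⟩
  · have h1 : 0 < k := by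
      by_contra hcon
      have : k ≤ -1 := by omega
      nlinarith
    have h2 : k < 3 := by nlinarith
    have : k = 1 ∨ k = 2 := by omega
    rcases this with rfl | rfl
    · exact ⟨-2, a, b, by simp, Or.inl (by linarith)⟩
    · have h2a : (2 : ℤ) ∣ a := by
        apply Int.prime_two.dvd_of_dvd_pow (n := 2)
        exact ⟨p - b ^ 2, by linarith⟩
      obtain ⟨a1, rfl⟩ := h2a
      exact ⟨-2, b, a1, by simp, Or.inl (by nlinarith)⟩
  · have h1 : k < 1 := by nlinarith
    have h2 : -2 < k := by nlinarith
    have : k = -1 := by omega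
    subst this
    exact ⟨2, a, b, by simp, Or.inr (by linarith)⟩

open NumberField

section KSide

set_option linter.unusedSectionVars false

variable (K : Type*) [Field K] [NumberField K] [IsCyclotomicExtension {8} ℚ K]

theorem aux_z4 {R : Type*} [CommRing R] [IsDomain R] {z : R} (hz : IsPrimitiveRoot z 8) :
    z ^ 4 = -1 := by
  have h8 : z ^ 8 = 1 := hz.pow_eq_one
  have h4 : z ^ 4 ≠ 1 := hz.pow_ne_one_of_pos_of_lt (by norm_num) (by norm_num)
  have : (z ^ 4 - 1) * (z ^ 4 + 1) = 0 := by linear_combination h8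
  rcases mul_eq_zero.mp this with h | h
  · exact absurd (sub_eq_zero.mp h) h4
  · linear_combination h

theorem aux_theta (c : ℤ) (hc : c = -1 ∨ c = -2 ∨ c = 2) : ∃ θ : 𝓞 K, θ ^ 2 = (c : 𝓞 K) := by
  have hz := (IsCyclotomicExtension.zeta_spec 8 ℚ K).toInteger_isPrimitiveRoot
  set z := (IsCyclotomicExtension.zeta_spec 8 ℚ K).toInteger
  have h4 : z ^ 4 = -1 := aux_z4 hz
  rcases hc with rfl | rfl | rfl
  · exact ⟨z ^ 2, by push_cast; linear_combination h4⟩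
  · exact ⟨z + z ^ 3, by push_cast; linear_combination (2 + z ^ 2) * h4⟩
  · exact ⟨z - z ^ 3, by push_cast; linear_combination (-2 + z ^ 2) * h4⟩

theorem aux_flip (c : ℤ) (hc : c = -1 ∨ c = -2 ∨ c = 2) (θ : K) (hθ : θ ^ 2 = (c : K)) :
    ∃ τ : K ≃ₐ[ℚ] K, τ θ = -θ := by
  have : IsGalois ℚ K := IsCyclotomicExtension.isGalois {8} ℚ K
  by_contra hcon
  push Not at hcon
  have hfix : ∀ τ : K ≃ₐ[ℚ] K, τ θ = θ := by
    intro τ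
    have h : (τ θ) ^ 2 = θ ^ 2 := by rw [← map_pow, hθ]; simp
    rcases sq_eq_sq_iff_eq_or_eq_neg.mp h with h | h
    · exact h
    · exact absurd h (hcon τ)
  obtain ⟨q, hq⟩ := (IsGalois.mem_bot_iff_fixed (F := ℚ) θ).mpr hfix
  apply aux_not_sq_s12 c hc q
  have hq' : algebraMap ℚ K q = θ := hq
  apply (algebraMap ℚ K).injective
  rw [map_pow, hq', hθ]; simp

theorem aux_split (p : ℕ) [hp : Fact p.Prime] (hp2 : p ≠ 2) :
    ∃ π π' : 𝓞 K, π * π' = (p : 𝓞 K) ∧ ¬ IsUnit π ∧ ¬ IsUnit π' ∧ IsCoprime π π' := by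
  suffices H : ∃ π π' : 𝓞 K, (π * π' = (p : 𝓞 K) ∨ π * π' = -(p : 𝓞 K)) ∧ ¬ IsUnit π ∧
      ¬ IsUnit π' ∧ IsCoprime π π' by
    obtain ⟨π, π', h | h, h1, h2, h3⟩ := H
    · exact ⟨π, π', h, h1, h2, h3⟩
    · exact ⟨π, -π', by rw [mul_neg, h, neg_neg], h1, by simpa using h2, h3.neg_right⟩
  obtain ⟨c, a, b, hc, hab, hco⟩ := aux_repr p hp2
  obtain ⟨θ, hθ⟩ := aux_theta K c hc
  obtain ⟨τ, hτ⟩ := aux_flip K c hc (θ : K) (by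
    have := congrArg (algebraMap (𝓞 K) K) hθ
    simpa using this)
  have hprod : ((a : 𝓞 K) + b * θ) * (a - b * θ) = ((a ^ 2 - c * b ^ 2 : ℤ) : 𝓞 K) := by
    push_cast
    linear_combination (-(b : 𝓞 K) ^ 2) * hθ
  have hprod' : (((a : 𝓞 K) + b * θ) * (a - b * θ) = (p : 𝓞 K) ∨
      ((a : 𝓞 K) + b * θ) * (a - b * θ) = -(p : 𝓞 K)) := by
    rw [hprod]
    rcases hab with h | h <;> rw [h] <;> simp
  have hpu : ¬ IsUnit (p : 𝓞 K) := by
    intro hu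
    have h1 := hu.map (Algebra.norm ℤ)
    have h2 : Algebra.norm ℤ (p : 𝓞 K) = (p : ℤ) ^ (Module.finrank ℤ (𝓞 K)) := by
      have := Algebra.norm_algebraMap (S := 𝓞 K) (p : ℤ)
      simpa using this
    rw [h2, isUnit_pow_iff (Module.finrank_pos).ne'] at h1
    exact (Nat.prime_iff_prime_int.mp hp.out).not_isUnit h1
  let τ' := RingOfIntegers.mapRingEquiv (τ : K ≃+* K)
  have hτ' : τ' θ = -θ := by
    apply RingOfIntegers.ext
    have : ((τ' θ : 𝓞 K) : K) = τ θ := rfl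
    rw [this, hτ]; simp
  have hconj1 : τ' ((a : 𝓞 K) + b * θ) = a - b * θ := by
    rw [map_add, map_mul, hτ']; simp; ring
  have hconj2 : τ' ((a : 𝓞 K) - b * θ) = a + b * θ := by
    rw [map_sub, map_mul, hτ']; simp
  have hpu' : ¬ IsUnit (((a : 𝓞 K) + b * θ) * (a - b * θ)) := by
    rcases hprod' with h | h <;> rw [h]
    · exact hpu
    · simpa using hpu
  refine ⟨a + b * θ, a - b * θ, hprod', ?_, ?_, ?_⟩
  · intro hu
    refine hpu' (hu.mul ?_)
    rw [← hconj1]; exact hu.map τ'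
  · intro hu
    refine hpu' (IsUnit.mul ?_ hu)
    rw [← hconj2]; exact hu.map τ'
  · obtain ⟨u, v, huv⟩ := hco
    have huv' : (u : 𝓞 K) * (2 * a) + v * p = 1 := by exact_mod_cast congrArg (Int.cast : ℤ → 𝓞 K) huv
    rcases hprod' with h | h
    · exact ⟨u + v * (a - b * θ), u, by linear_combination huv' + (v : 𝓞 K) * h⟩
    · exact ⟨u - v * (a - b * θ), u, by linear_combination huv' - (v : 𝓞 K) * h⟩

theorem aux_unram_s12 (p : ℕ) [hp : Fact p.Prime] (hp2 : p ≠ 2) (P : Ideal (𝓞 K)) [P.IsPrime]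
    (hP : (p : 𝓞 K) ∈ P) : (p : 𝓞 K) ∉ P ^ 2 := by
  have hmax : (Ideal.span {(p : ℤ)}).IsMaximal := Int.ideal_span_isMaximal_of_prime p
  have hlo : P.LiesOver (Ideal.span {(p : ℤ)}) := by
    refine ⟨hmax.eq_of_le (Ideal.IsPrime.ne_top inferInstance) ?_⟩
    rw [Ideal.span_singleton_le_iff_mem, Ideal.mem_comap]
    simpa using hP
  have h8 : ¬ p ∣ 8 := by
    intro h
    have : p ∣ 2 ^ 3 := h
    exact hp2 ((Nat.prime_dvd_prime_iff_eq hp.out Nat.prime_two).mp (hp.out.dvd_of_dvd_pow this))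
  have h := IsCyclotomicExtension.Rat.ramificationIdx_eq_of_not_dvd (m := 8) p K P h8
  rw [← Ideal.ramificationIdx'_eq_ramificationIdx (Ideal.span {(p : ℤ)}) P
    (by simpa using hp.out.ne_zero)] at h
  intro h2
  refine (Ideal.ramificationIdx'_ne_one_iff ?_).mpr ?_ h
  · rw [Ideal.map_span, Set.image_singleton, Ideal.span_singleton_le_iff_mem]; simpa using hP
  · rw [Ideal.map_span, Set.image_singleton, Ideal.span_singleton_le_iff_mem]; simpa using h2

open IsDedekindDomain WithZero in
theorem aux_val (p : ℕ) [hp : Fact p.Prime] (hp2 : p ≠ 2) (π π' : 𝓞 K)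
    (h : π * π' = (p : 𝓞 K)) (hu : ¬ IsUnit π) :
    ∃ v : HeightOneSpectrum (𝓞 K), v.intValuation π = exp (-1 : ℤ) ∧ (p : 𝓞 K) ∈ v.asIdeal ∧
      π ∈ v.asIdeal := by
  obtain ⟨M, hM, hπM⟩ := exists_max_ideal_of_mem_nonunits hu
  have hpM : (p : 𝓞 K) ∈ M := by rw [← h]; exact M.mul_mem_right _ hπM
  have hbot : M ≠ ⊥ := by
    rintro rfl
    rw [Ideal.mem_bot] at hpM
    exact hp.out.ne_zero (by exact_mod_cast hpM)
  have hMp : M.IsPrime := hM.isPrime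
  refine ⟨⟨M, hMp, hbot⟩, ?_, hpM, hπM⟩
  set v : HeightOneSpectrum (𝓞 K) := ⟨M, hMp, hbot⟩
  apply le_antisymm
  · have := (v.intValuation_le_pow_iff_mem π 1).mpr (by simpa using hπM)
    simpa using this
  · have h2 : π ∉ v.asIdeal ^ 2 := by
      intro h2
      apply aux_unram_s12 K p hp2 M hpM
      rw [← h]; exact Ideal.mul_mem_right _ _ h2
    rw [← v.intValuation_le_pow_iff_mem π 2, not_le] at h2
    have h0 : v.intValuation π ≠ 0 := fun h0 => by rw [h0] at h2; simp at h2
    rw [← exp_log h0] at h2 ⊢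
    rw [exp_lt_exp] at h2
    rw [exp_le_exp]
    push_cast at h2
    omega

theorem aux_notMem (p : ℕ) (P : Ideal (𝓞 K)) [P.IsPrime]
    (hP : (p : 𝓞 K) ∈ P) (n : ℤ) (hn : IsCoprime (p : ℤ) n) : (n : 𝓞 K) ∉ P := by
  intro h
  obtain ⟨u, v, huv⟩ := hn
  apply Ideal.IsPrime.ne_top (I := P) inferInstance
  rw [Ideal.eq_top_iff_one]
  have : (u : 𝓞 K) * p + v * n = 1 := by exact_mod_cast congrArg (Int.cast : ℤ → 𝓞 K) huv
  rw [← this]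
  exact P.add_mem (P.mul_mem_left _ hP) (P.mul_mem_left _ h)

open IsDedekindDomain WithZero in
theorem aux_parity (v : HeightOneSpectrum (𝓞 K)) (x : 𝓞 K) (hx : v.intValuation x = exp (-1 : ℤ)) :
    ¬ IsSquare (x : K) := by
  rintro ⟨y, hy⟩
  have h1 : v.valuation K (x : K) = exp (-1 : ℤ) := by
    rw [← hx]; exact HeightOneSpectrum.valuation_of_algebraMap v x
  rw [hy, map_mul] at h1
  have h0 : v.valuation K y ≠ 0 := fun h0 => by rw [h0, mul_zero] at h1; exact exp_ne_zero h1.symm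
  rw [← exp_log h0, ← exp_add, exp_inj] at h1
  omega

end KSide

section KUnits

variable (K : Type*) [Field K] [NumberField K] [IsCyclotomicExtension {8} ℚ K]

open ComplexConjugate in
theorem aux_eps (w θ : K) (hw : w ^ 8 = 1) (hθ : θ ^ 2 = 2) : ¬ IsSquare (w * (1 + θ)) := by
  rintro ⟨y, hy⟩
  have : IsCMField K := IsCyclotomicExtension.Rat.isCMField K (S := {8}) ⟨8, rfl, by norm_num⟩
  obtain ⟨τ, hτ⟩ := aux_flip K 2 (by simp) θ (by rw [hθ]; norm_num)
  obtain ⟨φ⟩ : Nonempty (K →+* ℂ) := inferInstance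
  have hreal : ∀ ψ : K →+* ℂ, ∃ r : ℝ, r ^ 2 = 2 ∧ ψ θ = r := by
    intro ψ
    have h1 : (ψ θ) ^ 2 = ((Real.sqrt 2 : ℝ) : ℂ) ^ 2 := by
      rw [← map_pow, hθ, ← Complex.ofReal_pow, Real.sq_sqrt (by norm_num)]
      simpa using map_ofNat ψ 2
    rcases sq_eq_sq_iff_eq_or_eq_neg.mp h1 with h | h
    · exact ⟨Real.sqrt 2, by simp, h⟩
    · exact ⟨-Real.sqrt 2, by simp, by rw [h]; simp⟩
  set N := y * IsCMField.complexConj K y with hN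
  have hNφ : ∀ ψ : K →+* ℂ, ψ N = (Complex.normSq (ψ y) : ℂ) := by
    intro ψ
    rw [hN, map_mul, IsCMField.complexEmbedding_complexConj, Complex.mul_conj]
  have hsq : N ^ 2 = (1 + θ) ^ 2 := by
    apply φ.injective
    obtain ⟨r, hr, hrθ⟩ := hreal φ
    have hwn : Complex.normSq (φ w) = 1 := by
      have h8 : (φ w) ^ 8 = 1 := by rw [← map_pow, hw, map_one]
      have := congrArg Complex.normSq h8
      rw [map_pow, map_one] at this
      exact (pow_eq_one_iff_of_nonneg (Complex.normSq_nonneg _) (by norm_num)).mp this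
    have h2 : Complex.normSq (φ y) ^ 2 = (1 + r) ^ 2 := by
      rw [sq, ← Complex.normSq_mul, ← map_mul, ← hy, map_mul, Complex.normSq_mul, hwn, one_mul,
        map_add, map_one, hrθ, ← Complex.ofReal_one, ← Complex.ofReal_add, Complex.normSq_ofReal]
      ring
    rw [map_pow, map_pow, hNφ, map_add, map_one, hrθ]
    exact_mod_cast h2
  obtain ⟨r, hr, hrθ⟩ := hreal φ
  have e1 := hNφ φ
  have e2 := hNφ (φ.comp (τ : K →+* K))
  have n1 := Complex.normSq_nonneg (φ y)
  have n2 := Complex.normSq_nonneg (φ.comp (τ : K →+* K) y)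
  have hτθ : φ (τ θ) = ((-r : ℝ) : ℂ) := by rw [hτ, map_neg, hrθ]; simp
  rcases sq_eq_sq_iff_eq_or_eq_neg.mp hsq with h | h
  · rw [h] at e1 e2
    simp only [RingHom.comp_apply, RingHom.coe_coe, map_add, map_one] at e1 e2 n2
    rw [hrθ] at e1
    rw [hτθ] at e2
    have e1' : 1 + r = Complex.normSq (φ y) := by exact_mod_cast e1
    have e2' : 1 + -r = Complex.normSq (φ (τ y)) := by exact_mod_cast e2
    nlinarith
  · rw [h] at e1 e2
    simp only [RingHom.comp_apply, RingHom.coe_coe, map_add, map_one, map_neg] at e1 e2 n2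
    rw [hrθ] at e1
    rw [hτθ] at e2
    have e1' : -(1 + r) = Complex.normSq (φ y) := by exact_mod_cast e1
    have e2' : -(1 + -r) = Complex.normSq (φ (τ y)) := by exact_mod_cast e2
    nlinarith

theorem aux_zns (z : K) (hz : IsPrimitiveRoot z 8) : ¬ IsSquare z := by
  rintro ⟨y, hy⟩
  have h8 : y ^ 8 = -1 := by
    have := aux_z4 hz
    rw [hy] at this
    rw [← this]; ring
  have ho : orderOf y = 2 ^ (3 + 1) := by
    apply orderOf_eq_prime_pow
    · norm_num
      rw [h8]
      norm_num
    · norm_num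
      rw [show (16 : ℕ) = 8 * 2 from rfl, pow_mul, h8]; norm_num
  have hy16 : IsPrimitiveRoot y 16 := by
    have := IsPrimitiveRoot.orderOf y
    rw [ho] at this
    exact this
  have h1 := IsPrimitiveRoot.lcm_totient_le_finrank (K := ℚ) hy16 hy16
    (Polynomial.cyclotomic.irreducible_rat (by decide))
  rw [IsCyclotomicExtension.finrank (n := 8) K (Polynomial.cyclotomic.irreducible_rat (by decide))] at h1
  revert h1
  decide

end KUnits

section KFinal

set_option linter.unusedSectionVars false

variable (K : Type*) [Field K] [NumberField K] [IsCyclotomicExtension {8} ℚ K]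

open IsDedekindDomain WithZero

theorem aux_one (v : HeightOneSpectrum (𝓞 K)) (x : 𝓞 K) (hx : x ∉ v.asIdeal) :
    v.intValuation x = 1 :=
  (v.intValuation_eq_one_iff_mem_primeCompl x).mpr hx

theorem aux_unit (v : HeightOneSpectrum (𝓞 K)) (x : 𝓞 K) (hx : IsUnit x) :
    v.intValuation x = 1 :=
  aux_one K v x (fun h => v.isPrime.ne_top (Ideal.eq_top_of_isUnit_mem _ h hx))

theorem aux_cop (v : HeightOneSpectrum (𝓞 K)) (x y : 𝓞 K) (h : IsCoprime x y)
    (hx : x ∈ v.asIdeal) : v.intValuation y = 1 := by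
  apply aux_one
  intro hy
  obtain ⟨a, b, hab⟩ := h
  apply v.isPrime.ne_top
  rw [Ideal.eq_top_iff_one, ← hab]
  exact Ideal.add_mem _ (Ideal.mul_mem_left _ _ hx) (Ideal.mul_mem_left _ _ hy)

theorem aux_prodval (v : HeightOneSpectrum (𝓞 K)) (κ : Fin 5 → 𝓞 K) (S : Finset (Fin 5))
    (j : Fin 5) (hj : j ∈ S) (h1 : v.intValuation (κ j) = exp (-1 : ℤ))
    (h2 : ∀ i, i ≠ j → v.intValuation (κ i) = 1) :
    v.intValuation (∏ i ∈ S, κ i) = exp (-1 : ℤ) := by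
  rw [map_prod, Finset.prod_eq_single_of_mem j hj (fun i _ hi => h2 i hi), h1]

theorem aux_K_s12 (p q : ℕ) [hp : Fact p.Prime] [hq : Fact q.Prime] (hp2 : p ≠ 2) (hq2 : q ≠ 2)
    (hpq : p ≠ q) (d dp dq : ℤ) (hdp : d = p * dp) (hdq : d = q * dq)
    (hcp : IsCoprime (p : ℤ) dp) (hcq : IsCoprime (q : ℤ) dq) :
    ∃ κ : Fin 5 → 𝓞 K, (∀ j, ∃ m, κ j * m = (d : 𝓞 K) ∧ IsCoprime (κ j) m) ∧
      ∀ S : Finset (Fin 5), S.Nonempty → ¬ IsSquare ((∏ j ∈ S, κ j : 𝓞 K) : K) ∧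
        ¬ IsSquare (((d : 𝓞 K) * ∏ j ∈ S, κ j : 𝓞 K) : K) := by
  obtain ⟨π, π', h1, hu, hu', hco⟩ := aux_split K p hp2
  obtain ⟨ρ, ρ', h2, hw, hw', hco'⟩ := aux_split K q hq2
  obtain ⟨θ, hθ⟩ := aux_theta K 2 (by simp)
  have hz := (IsCyclotomicExtension.zeta_spec 8 ℚ K).toInteger_isPrimitiveRoot
  have hzK : IsPrimitiveRoot (((IsCyclotomicExtension.zeta_spec 8 ℚ K).toInteger : 𝓞 K) : K) 8 :=
    IsCyclotomicExtension.zeta_spec 8 ℚ K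
  set z := (IsCyclotomicExtension.zeta_spec 8 ℚ K).toInteger
  have hzu : IsUnit z := hz.isUnit (by norm_num)
  have hεu : IsUnit (1 + θ) := by
    refine IsUnit.of_mul_eq_one (θ - 1) ?_
    push_cast at hθ
    linear_combination hθ
  have hpqZ : IsCoprime (p : ℤ) (q : ℤ) :=
    Nat.isCoprime_iff_coprime.mpr ((Nat.coprime_primes hp.out hq.out).mpr hpq)
  have hcast : ∀ a b : ℤ, IsCoprime a b → IsCoprime (a : 𝓞 K) (b : 𝓞 K) := fun a b h => by
    simpa using h.map (Int.castRingHom (𝓞 K))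
  have hcpK : IsCoprime (π * π') (dp : 𝓞 K) := by rw [h1]; simpa using hcast _ _ hcp
  have hcqK : IsCoprime (ρ * ρ') (dq : 𝓞 K) := by rw [h2]; simpa using hcast _ _ hcq
  have hcpqK : IsCoprime (π * π') (ρ * ρ') := by rw [h1, h2]; simpa using hcast _ _ hpqZ
  have hdpK : (d : 𝓞 K) = π * π' * dp := by rw [h1, hdp]; push_cast; ring
  have hdqK : (d : 𝓞 K) = ρ * ρ' * dq := by rw [h2, hdq]; push_cast; ring
  obtain ⟨v1, hv1, hv1p, hv1m⟩ := aux_val K p hp2 π π' h1 hu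
  obtain ⟨v2, hv2, hv2p, hv2m⟩ := aux_val K p hp2 π' π (by rw [mul_comm, h1]) hu'
  obtain ⟨v3, hv3, hv3p, hv3m⟩ := aux_val K q hq2 ρ ρ' h2 hw
  obtain ⟨v4, hv4, hv4p, hv4m⟩ := aux_val K q hq2 ρ' ρ (by rw [mul_comm, h2]) hw'
  let κ : Fin 5 → 𝓞 K := ![z, 1 + θ, π, π', ρ]
  have w1 : ∀ i, i ≠ 2 → v1.intValuation (κ i) = 1 := by
    intro i hi
    fin_cases i
    · exact aux_unit K v1 _ hzu
    · exact aux_unit K v1 _ hεu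
    · exact absurd rfl hi
    · exact aux_cop K v1 _ _ hco hv1m
    · exact aux_cop K v1 _ _ (hcpqK.of_mul_left_left.of_mul_right_left) hv1m
  have w2 : ∀ i, i ≠ 3 → v2.intValuation (κ i) = 1 := by
    intro i hi
    fin_cases i
    · exact aux_unit K v2 _ hzu
    · exact aux_unit K v2 _ hεu
    · exact aux_cop K v2 _ _ hco.symm hv2m
    · exact absurd rfl hi
    · exact aux_cop K v2 _ _ (hcpqK.of_mul_left_right.of_mul_right_left) hv2m
  have w3 : ∀ i, i ≠ 4 → v3.intValuation (κ i) = 1 := by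
    intro i hi
    fin_cases i
    · exact aux_unit K v3 _ hzu
    · exact aux_unit K v3 _ hεu
    · exact aux_cop K v3 _ _ (hcpqK.symm.of_mul_left_left.of_mul_right_left) hv3m
    · exact aux_cop K v3 _ _ (hcpqK.symm.of_mul_left_left.of_mul_right_right) hv3m
    · exact absurd rfl hi
  have w4 : ∀ i, v4.intValuation (κ i) = 1 := by
    intro i
    fin_cases i
    · exact aux_unit K v4 _ hzu
    · exact aux_unit K v4 _ hεu
    · exact aux_cop K v4 _ _ (hcpqK.symm.of_mul_left_right.of_mul_right_left) hv4m
    · exact aux_cop K v4 _ _ (hcpqK.symm.of_mul_left_right.of_mul_right_right) hv4m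
    · exact aux_cop K v4 _ _ hco'.symm hv4m
  refine ⟨κ, ?_, ?_⟩
  · have hunit : ∀ x : 𝓞 K, IsUnit x → ∃ m, x * m = (d : 𝓞 K) ∧ IsCoprime x m := by
      intro x hx
      obtain ⟨m, hm⟩ := hx.dvd (a := (d : 𝓞 K))
      obtain ⟨u, rfl⟩ := hx
      exact ⟨m, hm.symm, ↑u⁻¹, 0, by simp⟩
    intro j
    fin_cases j
    · exact hunit _ hzu
    · exact hunit _ hεu
    · exact ⟨π' * dp, by rw [hdpK]; simp only [κ]; simp; ring,
        IsCoprime.mul_right hco hcpK.of_mul_left_left⟩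
    · exact ⟨π * dp, by rw [hdpK]; simp only [κ]; simp; ring,
        IsCoprime.mul_right hco.symm hcpK.of_mul_left_right⟩
    · exact ⟨ρ' * dq, by rw [hdqK]; simp only [κ]; simp; ring,
        IsCoprime.mul_right hco' hcqK.of_mul_left_left⟩
  · intro S hS
    constructor
    · by_cases s2 : 2 ∈ S
      · exact aux_parity K v1 _ (aux_prodval K v1 κ S 2 s2 hv1 w1)
      by_cases s3 : 3 ∈ S
      · exact aux_parity K v2 _ (aux_prodval K v2 κ S 3 s3 hv2 w2)
      by_cases s4 : 4 ∈ S
      · exact aux_parity K v3 _ (aux_prodval K v3 κ S 4 s4 hv3 w3)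
      have hθK : (θ : K) ^ 2 = 2 := by
        have := congrArg (algebraMap (𝓞 K) K) hθ
        rw [map_pow, map_intCast] at this
        exact_mod_cast this
      have hcases : S = {0} ∨ S = {1} ∨ S = {0, 1} := by
        clear * - hS s2 s3 s4
        revert S
        decide
      rcases hcases with rfl | rfl | rfl
      · simpa [κ] using aux_zns K z hzK
      · simpa [κ] using aux_eps K 1 θ (by simp) hθK
      · simpa [κ] using aux_eps K z θ hzK.pow_eq_one hθK
    · apply aux_parity K v4
      rw [map_mul, map_prod, Finset.prod_eq_one (fun i _ => w4 i), mul_one, hdqK, map_mul, map_mul,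
        hv4, aux_cop K v4 _ _ hco'.symm hv4m, aux_cop K v4 _ _ hcqK.of_mul_left_right hv4m]
      simp

end KFinal

section LSide

set_option linter.unusedSectionVars false

theorem aux_zpow_sum {G ι : Type*} [CommGroup G] (S : Finset ι) (g : G) (f : ι → ℤ) :
    ∏ j ∈ S, g ^ f j = g ^ ∑ j ∈ S, f j := by
  classical
  induction S using Finset.induction_on with
  | empty => simp
  | insert a S ha ih => rw [Finset.prod_insert ha, Finset.sum_insert ha, zpow_add, ih]

variable (L : Type*) [Field L] [NumberField L]

theorem aux_pigeon (hr : Units.rank L ≤ 3) (u : Fin 5 → (𝓞 L)ˣ) :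
    ∃ S : Finset (Fin 5), S.Nonempty ∧ IsSquare (∏ j ∈ S, u j) := by
  classical
  obtain ⟨g, hg⟩ := IsCyclic.exists_generator (α := Units.torsion L)
  have hex : ∀ x : (𝓞 L)ˣ, ∃ (k : ℤ) (e : Fin (Units.rank L) → ℤ),
      x = (g : (𝓞 L)ˣ) ^ k * ∏ i, (Units.fundSystem L i) ^ (e i) := by
    intro x
    obtain ⟨⟨t, e⟩, hx, -⟩ := Units.exist_unique_eq_mul_prod L x
    obtain ⟨k, hk⟩ := Subgroup.mem_zpowers_iff.mp (hg t)
    refine ⟨k, e, ?_⟩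
    rw [hx, ← hk]
    simp
  choose k e hke using fun j => hex (u j)
  let w : Fin 5 → (Option (Fin (Units.rank L)) → ZMod 2) :=
    fun j o => o.elim (k j : ZMod 2) (fun i => (e j i : ZMod 2))
  have hdep : ¬ LinearIndependent (ZMod 2) w := by
    intro hli
    have := hli.fintype_card_le_finrank
    simp at this
    omega
  rw [Fintype.not_linearIndependent_iff] at hdep
  obtain ⟨c, hc, j0, hj0⟩ := hdep
  refine ⟨Finset.univ.filter (fun j => c j ≠ 0), ⟨j0, by simpa using hj0⟩, ?_⟩
  set S := Finset.univ.filter (fun j => c j ≠ 0) with hS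
  have hone : ∀ a : ZMod 2, a ≠ 0 → a = 1 := by decide
  have hsum : ∀ o, ∑ j ∈ S, w j o = 0 := by
    intro o
    have h1 := congrFun hc o
    rw [Finset.sum_apply] at h1
    rw [hS, Finset.sum_filter]
    refine Eq.trans ?_ h1
    refine Finset.sum_congr rfl (fun j _ => ?_)
    by_cases h : c j = 0
    · simp [h]
    · simp [hone _ h]
  have heven : ∀ f : Fin 5 → ℤ, ∑ j ∈ S, (f j : ZMod 2) = 0 → Even (∑ j ∈ S, f j) := by
    intro f hf
    rw [← ZMod.intCast_eq_zero_iff_even]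
    push_cast
    exact hf
  have hk2 := heven k (hsum none)
  have he2 := fun i => heven (fun j => e j i) (hsum (some i))
  have hprod : ∏ j ∈ S, u j = (g : (𝓞 L)ˣ) ^ (∑ j ∈ S, k j) *
      ∏ i, (Units.fundSystem L i) ^ (∑ j ∈ S, e j i) := by
    rw [Finset.prod_congr rfl (fun j _ => hke j), Finset.prod_mul_distrib, Finset.prod_comm]
    congr 1
    · rw [aux_zpow_sum]
    · refine Finset.prod_congr rfl (fun i _ => ?_)
      rw [aux_zpow_sum]
  rw [hprod]
  refine IsSquare.mul (Even.isSquare_zpow hk2 _) ?_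
  exact Finset.isSquare_prod _ (fun i _ => Even.isSquare_zpow (he2 i) _)

theorem aux_principal (hodd : ¬ 2 ∣ Nat.card (ClassGroup (𝓞 L))) (x m s : 𝓞 L)
    (h : x * m = s ^ 2) (hs : s ≠ 0) (hco : IsCoprime x m) :
    ∃ (α : 𝓞 L) (u : (𝓞 L)ˣ), x = α ^ 2 * u := by
  set P : Ideal (𝓞 L) := Ideal.span {x, s} with hP
  have hP2 : P ^ 2 = Ideal.span {x} := by
    apply le_antisymm
    · rw [sq, hP, Ideal.span_mul_span', Ideal.span_le]
      rintro _ ⟨a, ha, b, hb, rfl⟩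
      simp only [Set.mem_insert_iff, Set.mem_singleton_iff] at ha hb
      simp only [SetLike.mem_coe, Ideal.mem_span_singleton]
      rcases ha with rfl | rfl <;> rcases hb with rfl | rfl
      · exact Dvd.intro _ rfl
      · exact Dvd.intro _ rfl
      · exact Dvd.intro_left _ rfl
      · exact ⟨m, by rw [h]; ring⟩
    · rw [Ideal.span_singleton_le_iff_mem]
      obtain ⟨a, b, hab⟩ := hco
      have hx : x = a * (x * x) + b * (s * s) := by linear_combination (-x) * hab + b * h
      have hxP : x ∈ P := Ideal.subset_span (by simp)
      have hsP : s ∈ P := Ideal.subset_span (by simp)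
      rw [hx, sq]
      exact Ideal.add_mem _ (Ideal.mul_mem_left _ _ (Ideal.mul_mem_mul hxP hxP))
        (Ideal.mul_mem_left _ _ (Ideal.mul_mem_mul hsP hsP))
  have hP0 : P ∈ nonZeroDivisors (Ideal (𝓞 L)) := by
    rw [mem_nonZeroDivisors_iff_ne_zero]
    intro h0
    apply hs
    have : s ∈ P := Ideal.subset_span (by simp)
    rw [h0] at this
    simpa using this
  have hcl : ClassGroup.mk0 ⟨P, hP0⟩ ^ 2 = 1 := by
    rw [← map_pow, ClassGroup.mk0_eq_one_iff]
    exact ⟨x, by simpa using hP2⟩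
  have hcl1 : ClassGroup.mk0 ⟨P, hP0⟩ = 1 := by
    have h1 := orderOf_dvd_of_pow_eq_one hcl
    have h2 := orderOf_dvd_natCard (ClassGroup.mk0 ⟨P, hP0⟩)
    rcases (Nat.dvd_prime Nat.prime_two).mp h1 with h3 | h3
    · exact orderOf_eq_one_iff.mp h3
    · rw [h3] at h2; exact absurd h2 hodd
  rw [ClassGroup.mk0_eq_one_iff] at hcl1
  obtain ⟨α, hα⟩ := hcl1
  have hα' : P = Ideal.span {α} := hα
  rw [hα', Ideal.span_singleton_pow, Ideal.span_singleton_eq_span_singleton] at hP2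
  obtain ⟨u, hu⟩ := hP2
  exact ⟨α, u, hu.symm⟩

variable (K : Type*) [Field K] [NumberField K] [IsCyclotomicExtension {8} ℚ K] [Algebra K L]

theorem aux_rank (s : L) (hx : ∀ x : L, ∃ a b : K, x = algebraMap K L a + algebraMap K L b * s) :
    Units.rank L ≤ 3 := by
  have h4 : Module.finrank ℚ K = 4 := by
    rw [IsCyclotomicExtension.finrank (n := 8) K
      (Polynomial.cyclotomic.irreducible_rat (by decide))]
    decide
  have hspan : Submodule.span K (Set.range ![1, s]) = ⊤ := by
    rw [eq_top_iff]
    rintro x -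
    obtain ⟨a, b, rfl⟩ := hx x
    refine Submodule.add_mem _ ?_ ?_
    · have := Submodule.smul_mem (Submodule.span K (Set.range ![1, s])) a
        (Submodule.subset_span ⟨0, rfl⟩)
      simpa [Algebra.smul_def] using this
    · have := Submodule.smul_mem (Submodule.span K (Set.range ![1, s])) b
        (Submodule.subset_span ⟨1, rfl⟩)
      simpa [Algebra.smul_def] using this
  have h2 : Module.finrank K L ≤ 2 := by
    have := finrank_range_le_card (R := K) ![1, s]
    rw [Set.finrank, hspan, finrank_top] at this
    simpa using this
  have h8 : Module.finrank ℚ L ≤ 8 := by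
    rw [← Module.finrank_mul_finrank ℚ K L, h4]; omega
  have : IsTotallyComplex K := IsCyclotomicExtension.Rat.isTotallyComplex K (n := 8) (by norm_num)
  have : IsTotallyComplex L := isTotallyComplex_of_algebra K L
  have h := InfinitePlace.card_add_two_mul_card_eq_rank L
  have hr : InfinitePlace.nrRealPlaces L = 0 := IsTotallyComplex.nrRealPlaces_eq_zero L
  have hc := InfinitePlace.card_eq_nrRealPlaces_add_nrComplexPlaces L
  rw [Units.rank, hc]
  omega

theorem aux_descend (s : L) (D : K) (hs : s ^ 2 = algebraMap K L D)
    (hx : ∀ x : L, ∃ a b : K, x = algebraMap K L a + algebraMap K L b * s) (κ : K)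
    (h : IsSquare (algebraMap K L κ)) : IsSquare κ ∨ IsSquare (D * κ) := by
  obtain ⟨y, hy⟩ := h
  have inj := (algebraMap K L).injective
  by_cases hsK : ∃ t : K, s = algebraMap K L t
  · obtain ⟨t, rfl⟩ := hsK
    obtain ⟨a, b, rfl⟩ := hx y
    left
    refine ⟨a + b * t, inj ?_⟩
    rw [hy]; simp
  · obtain ⟨a, b, rfl⟩ := hx y
    have hab : a * b = 0 := by
      by_contra hab
      apply hsK
      have h0 : algebraMap K L a * algebraMap K L b ≠ 0 := by
        rw [← map_mul]; simpa using hab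
      have ha0 := left_ne_zero_of_mul h0
      have hb0 := right_ne_zero_of_mul h0
      refine ⟨(κ - a ^ 2 - b ^ 2 * D) / (2 * (a * b)), ?_⟩
      have : CharZero L := inferInstance
      simp only [map_div₀, map_sub, map_mul, map_pow, map_ofNat]
      rw [eq_div_iff (mul_ne_zero two_ne_zero h0), hy, ← hs]
      ring
    rcases mul_eq_zero.mp hab with rfl | rfl
    · right
      refine ⟨b * D, inj ?_⟩
      rw [map_mul, hy, map_mul, map_mul, ← hs, map_zero]
      ring
    · left
      refine ⟨a, inj ?_⟩
      rw [hy]; simp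

end LSide

theorem aux_primes (d : ℤ) (hodd : Odd d) (hd : Squarefree d)
    (hcomp : 1 < d.natAbs ∧ ¬ d.natAbs.Prime) :
    ∃ p q : ℕ, p.Prime ∧ q.Prime ∧ p ≠ 2 ∧ q ≠ 2 ∧ p ≠ q ∧ (p : ℤ) ∣ d ∧ (q : ℤ) ∣ d := by
  obtain ⟨h1, h2⟩ := hcomp
  have hp : (d.natAbs.minFac).Prime := Nat.minFac_prime h1.ne'
  set p := d.natAbs.minFac with hpdef
  obtain ⟨n, hn⟩ : p ∣ d.natAbs := Nat.minFac_dvd _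
  have hn1 : n ≠ 1 := by
    rintro rfl
    rw [mul_one] at hn
    exact h2 (hn ▸ hp)
  have hq : (n.minFac).Prime := Nat.minFac_prime hn1
  obtain ⟨k, hk⟩ : n.minFac ∣ n := Nat.minFac_dvd _
  set q := n.minFac with hqdef
  have hoddn : Odd d.natAbs := Int.natAbs_odd.mpr hodd
  have hsq : Squarefree d.natAbs := Int.squarefree_natAbs.mpr hd
  have hpd : p ∣ d.natAbs := ⟨n, hn⟩
  have hqd : q ∣ d.natAbs := ⟨p * k, by rw [hn, hk]; ring⟩
  have hne2 : ∀ r : ℕ, r ∣ d.natAbs → r ≠ 2 := by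
    rintro r hr rfl
    exact (Nat.not_even_iff_odd.mpr hoddn) (even_iff_two_dvd.mpr hr)
  refine ⟨p, q, hp, hq, hne2 p hpd, hne2 q hqd, ?_, Int.natCast_dvd.mpr hpd,
    Int.natCast_dvd.mpr hqd⟩
  intro hpq
  have : IsUnit p := hsq p ⟨k, by rw [hn, hk, ← hpq]; ring⟩
  exact hp.one_lt.ne' (Nat.isUnit_iff.mp this)

theorem aux_cofactor (d : ℤ) (hd : Squarefree d) (p : ℕ) (h : (p : ℤ) ∣ d) :
    ∃ dp : ℤ, d = p * dp ∧ IsCoprime (p : ℤ) dp := by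
  obtain ⟨dp, rfl⟩ := h
  exact ⟨dp, rfl, (squarefree_mul_iff.mp hd).1.isCoprime⟩

open IntermediateField in
/-- Let `d` be an odd squarefree integer with `|d|` composite. Then the class number of
`L_d = ℚ(ζ₈, √d)` is even, i.e. the 2-class group of `L_d` is nontrivial. -/
theorem stmt_12 (d : ℤ) (hodd : Odd d) (hd : Squarefree d)
    (hcomp : 1 < d.natAbs ∧ ¬ d.natAbs.Prime)
    (L : Type) [Field L] [NumberField L]
    (ζ : L) (hζ : IsPrimitiveRoot ζ 8) (s : L) (hs : s ^ 2 = (d : L))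
    (hgen : Algebra.adjoin ℚ {ζ, s} = ⊤) :
    2 ∣ Nat.card (ClassGroup (𝓞 L)) := by
  by_contra hcl
  obtain ⟨p, q, hp, hq, hp2, hq2, hpq, hpd, hqd⟩ := aux_primes d hodd hd hcomp
  obtain ⟨dp, hdp, hcp⟩ := aux_cofactor d hd p hpd
  obtain ⟨dq, hdq, hcq⟩ := aux_cofactor d hd q hqd
  have : Fact p.Prime := ⟨hp⟩
  have : Fact q.Prime := ⟨hq⟩
  have hcyc : IsCyclotomicExtension {8} ℚ ℚ⟮ζ⟯ := hζ.intermediateField_adjoin_isCyclotomicExtension ℚ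
  have hnf : NumberField ℚ⟮ζ⟯ := NumberField.of_intermediateField _
  have hx : ∀ x : L, ∃ a b : ℚ⟮ζ⟯, x = algebraMap ℚ⟮ζ⟯ L a + algebraMap ℚ⟮ζ⟯ L b * s := by
    intro x
    have hxm : x ∈ Algebra.adjoin ℚ {ζ, s} := by rw [hgen]; trivial
    induction hxm using Algebra.adjoin_induction with
    | mem x hx =>
      simp only [Set.mem_insert_iff, Set.mem_singleton_iff] at hx
      rcases hx with rfl | rfl
      · exact ⟨AdjoinSimple.gen ℚ x, 0, by simp⟩
      · exact ⟨0, 1, by simp⟩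
    | algebraMap r => exact ⟨algebraMap ℚ _ r, 0, by simp⟩
    | add x y _ _ hx hy =>
      obtain ⟨a, b, rfl⟩ := hx
      obtain ⟨a', b', rfl⟩ := hy
      exact ⟨a + a', b + b', by simp only [map_add]; ring⟩
    | mul x y _ _ hx hy =>
      obtain ⟨a, b, rfl⟩ := hx
      obtain ⟨a', b', rfl⟩ := hy
      refine ⟨a * a' + b * b' * (d : ℚ⟮ζ⟯), a * b' + a' * b, ?_⟩
      simp only [map_add, map_mul, map_intCast]
      linear_combination (algebraMap ℚ⟮ζ⟯ L b * algebraMap ℚ⟮ζ⟯ L b') * hs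
  obtain ⟨κ, hκ, hκS⟩ := aux_K_s12 ℚ⟮ζ⟯ p q hp2 hq2 hpq d dp dq hdp hdq hcp hcq
  have hsint : IsIntegral ℤ s := by
    apply IsIntegral.of_pow (n := 2) (by norm_num)
    rw [hs]
    exact isIntegral_algebraMap (R := ℤ) (x := d)
  let sI : 𝓞 L := ⟨s, hsint⟩
  have hsI : sI ^ 2 = (d : 𝓞 L) := by
    apply RingOfIntegers.ext
    change algebraMap (𝓞 L) L (sI ^ 2) = algebraMap (𝓞 L) L (d : 𝓞 L)
    rw [map_pow, map_intCast]
    exact hs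
  have hs0 : sI ≠ 0 := by
    intro h0
    rw [h0] at hsI
    have : (d : 𝓞 L) = 0 := by rw [← hsI]; simp
    exact hd.ne_zero (by exact_mod_cast this)
  have hroot : ∀ j, ∃ (α : 𝓞 L) (u : (𝓞 L)ˣ), algebraMap (𝓞 ℚ⟮ζ⟯) (𝓞 L) (κ j) = α ^ 2 * u := by
    intro j
    obtain ⟨m, hm, hco⟩ := hκ j
    refine aux_principal L hcl _ (algebraMap (𝓞 ℚ⟮ζ⟯) (𝓞 L) m) sI ?_ hs0
      (hco.map (algebraMap (𝓞 ℚ⟮ζ⟯) (𝓞 L)))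
    rw [← map_mul, hm, hsI, map_intCast]
  choose α u hαu using hroot
  obtain ⟨S, hS, w, hw⟩ := aux_pigeon L (aux_rank L ℚ⟮ζ⟯ s hx) u
  have hsq : algebraMap (𝓞 ℚ⟮ζ⟯) (𝓞 L) (∏ j ∈ S, κ j) =
      ((∏ j ∈ S, α j) * w) * ((∏ j ∈ S, α j) * w) := by
    have hw' : ∏ j ∈ S, (u j : 𝓞 L) = w * w := by
      have := congrArg (Units.val) hw
      simpa using this
    rw [map_prod, Finset.prod_congr rfl (fun j _ => hαu j), Finset.prod_mul_distrib, hw',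
      Finset.prod_pow]
    ring
  have hsqL : IsSquare (algebraMap ℚ⟮ζ⟯ L ((∏ j ∈ S, κ j : 𝓞 ℚ⟮ζ⟯) : ℚ⟮ζ⟯)) := by
    refine ⟨(((∏ j ∈ S, α j) * w : 𝓞 L) : L), ?_⟩
    rw [← map_mul, ← hsq]
    rfl
  obtain ⟨n1, n2⟩ := hκS S hS
  rcases aux_descend L ℚ⟮ζ⟯ s (d : ℚ⟮ζ⟯) (by rw [hs]; simp) hx _ hsqL with h | h
  · exact n1 h
  · apply n2
    change IsSquare (algebraMap (𝓞 ℚ⟮ζ⟯) ℚ⟮ζ⟯ ((d : 𝓞 ℚ⟮ζ⟯) * ∏ j ∈ S, κ j))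
    rw [map_mul, map_intCast]
    exact h
end

section
/- Let $p$ be a prime with $p \equiv 1 \pmod 8$. Then the class number of $L_p = \mathbb{Q}(\zeta_8, \sqrt{p})$ is even. -/
open NumberField

theorem pigeon_aux {E : Type*} [AddCommGroup E] [Module.Finite ℤ E]
    (hr : Module.finrank ℤ E ≤ 2) (t : E)
    (ht : ∀ x ∈ Submodule.torsion ℤ E, ∃ k : ℤ, x = k • t) (F : Finset (Fin 4) → E) :
    ∃ S S' : Finset (Fin 4), S ≠ S' ∧ ∃ w : E, F S = F S' + (2 : ℤ) • w := by
  classical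
  let Q := E ⧸ Submodule.torsion ℤ E
  have hQ : Module.finrank ℤ Q ≤ 2 := by
    have := rank_quotient_eq_of_le_torsion (R := ℤ) (M := E) le_rfl
    rw [Module.finrank, this]; exact hr
  have : Module.Free ℤ Q := inferInstance
  let b := Module.finBasis ℤ Q
  have hsurj := Submodule.mkQ_surjective (Submodule.torsion ℤ E)
  choose g hg using fun i => hsurj (b i)
  have key : ∀ x : E, ∃ k : ℤ, x = ∑ i, (b.repr (Submodule.mkQ _ x) i) • g i + k • t := by
    intro x
    obtain ⟨k, hk⟩ := ht (x - ∑ i, (b.repr (Submodule.mkQ _ x) i) • g i) (by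
      rw [← Submodule.Quotient.mk_eq_zero, ← Submodule.mkQ_apply, map_sub, map_sum]
      simp only [map_smul, hg]
      rw [b.sum_repr, sub_self])
    exact ⟨k, by rw [← hk]; abel⟩
  choose k hk using key
  let φ : Finset (Fin 4) → (Fin (Module.finrank ℤ Q) → ZMod 2) × ZMod 2 := fun S =>
    (fun i => ((b.repr (Submodule.mkQ _ (F S)) i : ℤ) : ZMod 2), ((k (F S) : ℤ) : ZMod 2))
  have hni : ¬ Function.Injective φ := by
    intro h
    have h1 := Fintype.card_le_of_injective φ h
    have h2 : 2 ^ Module.finrank ℤ Q ≤ 2 ^ 2 := Nat.pow_le_pow_right (by norm_num) hQ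
    simp [ZMod.card] at h1
    omega
  rw [Function.Injective] at hni
  push Not at hni
  obtain ⟨S, S', hφ, hne⟩ := hni
  refine ⟨S, S', hne, ?_⟩
  have h1 : ∀ i, ∃ d : ℤ, b.repr (Submodule.mkQ _ (F S)) i = b.repr (Submodule.mkQ _ (F S')) i + 2 * d := by
    intro i
    have := congrFun (congrArg Prod.fst hφ) i
    have := (ZMod.intCast_eq_intCast_iff_dvd_sub _ _ 2).1 this.symm
    obtain ⟨d, hd⟩ := this
    exact ⟨d, by push_cast at hd; linarith⟩
  have h2 : ∃ d : ℤ, k (F S) = k (F S') + 2 * d := by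
    have := congrArg Prod.snd hφ
    have := (ZMod.intCast_eq_intCast_iff_dvd_sub _ _ 2).1 this.symm
    obtain ⟨d, hd⟩ := this
    exact ⟨d, by push_cast at hd; linarith⟩
  choose d hd using h1
  obtain ⟨d', hd'⟩ := h2
  refine ⟨∑ i, d i • g i + d' • t, ?_⟩
  have e1 := hk (F S)
  simp only [hd, hd', add_smul, mul_smul, Finset.sum_add_distrib] at e1
  rw [e1]
  conv_rhs => rw [hk (F S')]
  simp only [smul_add, Finset.smul_sum]
  abel

theorem units_aux (L : Type) [Field L] [NumberField L] (hrank : NumberField.Units.rank L ≤ 3)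
    (σ : (𝓞 L)ˣ →* (𝓞 L)ˣ) (ε : (𝓞 L)ˣ) (hε : σ ε = ε) (hε' : ∀ n : ℤ, ε ^ n = 1 → n = 0)
    (F : Finset (Fin 4) → (𝓞 L)ˣ) (hF : ∀ S, F S * σ (F S) = 1) :
    ∃ S S' : Finset (Fin 4), S ≠ S' ∧ ∃ w : (𝓞 L)ˣ, w * σ w = 1 ∧ F S = F S' * w ^ 2 := by
  classical
  have hfin : Module.Finite ℤ (Additive (𝓞 L)ˣ) := inferInstance
  have hfr := NumberField.Units.finrank_eq (K := L)
  let E : Submodule ℤ (Additive (𝓞 L)ˣ) :=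
    AddSubgroup.toIntSubmodule (Subgroup.toAddSubgroup
      (MonoidHom.ker ((MonoidHom.id (𝓞 L)ˣ) * σ)))
  have hmem : ∀ u : (𝓞 L)ˣ, Additive.ofMul u ∈ E ↔ u * σ u = 1 := fun u => Iff.rfl
  have hE : Module.finrank ℤ E ≤ 2 := by
    let T : Submodule ℤ (Additive (𝓞 L)ˣ) := Submodule.span ℤ {Additive.ofMul ε}
    by_contra hcon
    push Not at hcon
    have : 3 + 1 ≤ Module.finrank ℤ (Additive (𝓞 L)ˣ) := by
      obtain ⟨f, hf⟩ := exists_linearIndependent_of_le_finrank (R := ℤ) (M := E) (n := 3) hcon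
      have hf' : LinearIndependent ℤ (fun i => (f i : Additive (𝓞 L)ˣ)) :=
        hf.map' E.subtype (Submodule.ker_subtype E)
      have hli : LinearIndependent ℤ (Fin.cons (Additive.ofMul ε)
          (fun i => (f i : Additive (𝓞 L)ˣ)) : Fin 4 → _) := by
        rw [Fintype.linearIndependent_iff] at hf' ⊢
        intro c hc
        rw [Fin.sum_univ_succ] at hc
        simp only [Fin.cons_zero, Fin.cons_succ] at hc
        have hin : c 0 • Additive.ofMul ε ∈ E := by
          rw [eq_neg_of_add_eq_zero_left hc]
          exact E.neg_mem (E.sum_mem fun i _ => E.smul_mem _ (f i).2)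
        have h0 : c 0 = 0 := by
          rw [← ofMul_zpow, hmem, map_zpow, hε, ← zpow_add] at hin
          have := hε' _ hin
          omega
        rw [h0, zero_smul, zero_add] at hc
        have := hf' _ hc
        intro i
        exact Fin.cases h0 this i
      have := hli.fintype_card_le_finrank
      simpa using this
    omega
  have hT : ∃ t : E, ∀ x ∈ Submodule.torsion ℤ E, ∃ k : ℤ, x = k • t := by
    have hcyc : IsCyclic (NumberField.Units.torsion L) := inferInstance
    let Z : AddSubgroup E := (Submodule.torsion ℤ E).toAddSubgroup
    have hZ : ∀ x : E, x ∈ Submodule.torsion ℤ E → (x : Additive (𝓞 L)ˣ).toMul ∈ NumberField.Units.torsion L := by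
      intro x hx
      rw [Submodule.mem_torsion_iff] at hx
      obtain ⟨a, ha⟩ := hx
      rw [NumberField.Units.torsion, CommGroup.mem_torsion, isOfFinOrder_iff_zpow_eq_one]
      refine ⟨a, nonZeroDivisors.coe_ne_zero a, ?_⟩
      exact congrArg (fun y : E => (y : Additive (𝓞 L)ˣ).toMul) ha
    let f : Multiplicative Z →* NumberField.Units.torsion L :=
      { toFun := fun x => ⟨((x.toAdd : E) : Additive (𝓞 L)ˣ).toMul, hZ _ (x.toAdd).2⟩
        map_one' := rfl
        map_mul' := fun _ _ => rfl }
    have hf : Function.Injective f := by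
      intro x y h
      have := congrArg Subtype.val h
      exact Subtype.ext (Subtype.ext this)
    have : IsCyclic (Multiplicative Z) := isCyclic_of_injective f hf
    obtain ⟨t, ht⟩ := this.exists_generator
    refine ⟨(t.toAdd : E), fun x hx => ?_⟩
    obtain ⟨k, hk⟩ := ht (Multiplicative.ofAdd ⟨x, hx⟩)
    exact ⟨k, (congrArg (fun y : Multiplicative Z => (y.toAdd : E)) hk).symm⟩
  obtain ⟨t, ht⟩ := hT
  obtain ⟨S, S', hne, w, hw⟩ := pigeon_aux hE t ht (fun S => ⟨Additive.ofMul (F S), (hmem _).2 (hF S)⟩)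
  refine ⟨S, S', hne, (w : Additive (𝓞 L)ˣ).toMul, (hmem _).1 w.2, ?_⟩
  have := congrArg (fun y : E => (y : Additive (𝓞 L)ˣ).toMul) hw
  simpa using this

theorem even_ram (p : ℕ) (hp : p.Prime) (K L : Type) [Field K] [NumberField K] [Field L]
    [NumberField L] [Algebra K L] (s : 𝓞 L) (hs : s ^ 2 = (p : 𝓞 L))
    (q : Ideal (𝓞 K)) [q.IsPrime] [q.LiesOver (Ideal.span {(p : ℤ)})]
    (hq : q.ramificationIdx ℤ = 1) (P : Ideal (𝓞 L)) [P.IsPrime] [P.LiesOver q] :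
    Even (P.ramificationIdx (𝓞 K)) := by
  have h1 := Ideal.ramificationIdx_tower (R := ℤ) q P
  rw [hq, one_mul] at h1
  rw [← h1]
  have : P.LiesOver (Ideal.span {(p : ℤ)}) := Ideal.LiesOver.trans P q _
  have hmap : Ideal.map (algebraMap ℤ (𝓞 L)) (Ideal.span {(p : ℤ)}) = Ideal.span {s} ^ 2 := by
    rw [Ideal.map_span, Set.image_singleton, Ideal.span_singleton_pow, hs]
    simp
  have hs0 : s ≠ 0 := by
    rintro rfl
    have : (p : 𝓞 L) = 0 := by rw [← hs]; simp
    exact hp.ne_zero (by exact_mod_cast this)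
  have hne : Ideal.map (algebraMap ℤ (𝓞 L)) (Ideal.span {(p : ℤ)}) ≠ ⊥ := by
    rw [hmap]
    exact pow_ne_zero 2 (by simpa [Ideal.span_singleton_eq_bot] using hs0)
  rw [Ideal.IsDedekindDomain.ramificationIdx_eq_normalizedFactors_count
    (Ideal.span {(p : ℤ)}) P hne, hmap, UniqueFactorizationMonoid.normalizedFactors_pow]
  simp

theorem unique_over (K L : Type) [Field K] [NumberField K] [Field L]
    [NumberField L] [Algebra K L] (h2 : Module.finrank K L ≤ 2) (q : Ideal (𝓞 K)) [q.IsPrime]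
    (hq : q ≠ ⊥) 
    (heven : ∀ (P : Ideal (𝓞 L)) [P.IsPrime] [P.LiesOver q], Even (P.ramificationIdx (𝓞 K))) :
    Module.finrank K L = 2 ∧ ∀ (P Q : Ideal (𝓞 L)) [P.IsPrime] [P.LiesOver q] [Q.IsPrime] [Q.LiesOver q], P = Q := by
  classical
  have hm : q.IsMaximal := Ideal.IsPrime.isMaximal inferInstance hq
  have hsum := Ideal.sum_ramification_inertia (𝓞 L) K L hq
  have hge : ∀ P ∈ IsDedekindDomain.primesOverFinset q (𝓞 L),
      2 ≤ Ideal.ramificationIdx' q P * Ideal.inertiaDeg' q P := by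
    intro P hP
    rw [IsDedekindDomain.mem_primesOverFinset_iff hq] at hP
    obtain ⟨hP1, hP2⟩ := hP
    have h1 := heven P
    have h0 := P.ramificationIdx_pos (𝓞 K)
    have h3 := Nat.pos_of_ne_zero (Ideal.inertiaDeg'_ne_zero q P)
    rw [Ideal.ramificationIdx'_eq_ramificationIdx q P hq]
    have : 2 ≤ P.ramificationIdx (𝓞 K) := by
      obtain ⟨k, hk⟩ := h1
      omega
    nlinarith
  have hcard := Finset.card_nsmul_le_sum _ _ 2 hge
  rw [hsum] at hcard
  have hc1 : (IsDedekindDomain.primesOverFinset q (𝓞 L)).card ≤ 1 := by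
    simp at hcard; omega
  constructor
  · obtain ⟨P, hP1, hP2⟩ := (q.nonempty_primesOver (S := 𝓞 L))
    have hP : P ∈ IsDedekindDomain.primesOverFinset q (𝓞 L) :=
      (IsDedekindDomain.mem_primesOverFinset_iff hq _).2 ⟨hP1, hP2⟩
    have := Finset.card_pos.2 ⟨P, hP⟩
    simp at hcard
    omega
  · intro P Q _ _ _ _
    exact Finset.card_le_one.1 hc1 P ((IsDedekindDomain.mem_primesOverFinset_iff hq _).2 ⟨‹_›, ‹_›⟩)
      Q ((IsDedekindDomain.mem_primesOverFinset_iff hq _).2 ⟨‹_›, ‹_›⟩)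

theorem even_mult (K L : Type) [Field K] [NumberField K] [Field L]
    [NumberField L] [Algebra K L] (q : Ideal (𝓞 K)) [q.IsPrime]
    (hq : q ≠ ⊥) (P : Ideal (𝓞 L)) [P.IsPrime] [P.LiesOver q] (h : Even (P.ramificationIdx (𝓞 K)))
    (a : 𝓞 K) (ha : a ≠ 0) :
    ∃ m : ℕ, emultiplicity P (Ideal.span {algebraMap (𝓞 K) (𝓞 L) a}) = ((2 * m : ℕ) : ℕ∞) := by
  have hP : P ≠ ⊥ := Ideal.ne_bot_of_liesOver_of_ne_bot hq P
  have h1 : Ideal.span {a} ≠ ⊥ := by simpa [Ideal.span_singleton_eq_bot] using ha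
  have hqi := (Ideal.prime_of_isPrime hq inferInstance)
  have := Ideal.IsDedekindDomain.emultiplicity_map_eq_ramificationIdx'_mul (S := 𝓞 L) (v := q) (w := P) h1
    hqi.irreducible (Ideal.prime_of_isPrime hP inferInstance).irreducible hP
  rw [Ideal.map_span, Set.image_singleton, Ideal.ramificationIdx'_eq_ramificationIdx q P hq] at this
  rw [this]
  obtain ⟨k, hk⟩ := h
  have hf : FiniteMultiplicity q (Ideal.span {a}) := FiniteMultiplicity.of_prime_left hqi h1
  refine ⟨k * multiplicity q (Ideal.span {a}), ?_⟩
  rw [hf.emultiplicity_eq_multiplicity, hk]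
  push_cast
  ring

theorem exists_sigma (K L : Type) [Field K] [NumberField K] [Field L]
    [NumberField L] [Algebra K L] (h2 : Module.finrank K L = 2) :
    ∃ σ : L ≃ₐ[K] L, (∀ x, σ (σ x) = x) ∧ ∀ x, σ x = x → ∃ a : K, algebraMap K L a = x := by
  have : Algebra.IsQuadraticExtension K L := ⟨h2⟩
  have : IsGalois K L := {}
  have hc : Nat.card (L ≃ₐ[K] L) = 2 := by rw [IsGalois.card_aut_eq_finrank, h2]
  obtain ⟨σ, hσ⟩ := (Nat.card_eq_two_iff' (1 : L ≃ₐ[K] L)).1 hc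
  have hsq : σ * σ = 1 := by
    have := pow_card_eq_one' (x := σ)
    rwa [hc, pow_two] at this
  refine ⟨σ, fun x => by simpa using congrArg (fun f : L ≃ₐ[K] L => f x) hsq, fun x hx => ?_⟩
  have := (IsGalois.mem_bot_iff_fixed (F := K) (E := L) x).2 (by
    intro f
    by_cases hf : f = 1
    · simp [hf]
    · rw [hσ.2 f hf, hx])
  exact IntermediateField.mem_bot.1 this

theorem core (K L : Type) [Field K] [NumberField K] [Field L]
    [NumberField L] [Algebra K L] (h2 : Module.finrank K L ≤ 2)
    (hrank : NumberField.Units.rank L ≤ 3)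
    (q : Fin 4 → Ideal (𝓞 K)) (hqi : Function.Injective q) (hqp : ∀ i, (q i).IsPrime)
    (hq0 : ∀ i, q i ≠ ⊥)
    (heven : ∀ i, ∀ (P : Ideal (𝓞 L)) [P.IsPrime] [P.LiesOver (q i)],
      Even (P.ramificationIdx (𝓞 K)))
    (ε : (𝓞 K)ˣ) (hε' : ∀ n : ℤ, ε ^ n = 1 → n = 0) :
    Even (Nat.card (ClassGroup (𝓞 L))) := by
  classical
  by_contra hodd
  rw [Nat.not_even_iff_odd] at hodd
  set h := Nat.card (ClassGroup (𝓞 L)) with hh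
  have h2' := (unique_over K L h2 (q 0) (hq0 0) (heven 0)).1
  have huniq := fun i => (unique_over K L h2 (q i) (hq0 i) (heven i)).2
  obtain ⟨σ, hσ2, hσfix⟩ := exists_sigma K L h2'
  let τ : 𝓞 L ≃+* 𝓞 L := RingOfIntegers.mapRingEquiv σ.toRingEquiv
  have hτ : ∀ x : 𝓞 L, ((τ x : 𝓞 L) : L) = σ (x : L) := fun x => rfl
  have hτ2 : ∀ x, τ (τ x) = x := fun x => RingOfIntegers.ext (by rw [hτ, hτ, hσ2])
  have hτK : ∀ a : 𝓞 K, τ (algebraMap (𝓞 K) (𝓞 L) a) = algebraMap (𝓞 K) (𝓞 L) a := by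
    intro a
    apply RingOfIntegers.ext
    rw [hτ]
    exact σ.commutes (a : K)
  have hex : ∀ i, ∃ P : Ideal (𝓞 L), P.IsPrime ∧ P.LiesOver (q i) := by
    intro i
    obtain ⟨P, hP1, hP2⟩ := ((q i).nonempty_primesOver (S := 𝓞 L))
    exact ⟨P, hP1, hP2⟩
  choose P hP1 hP2 using hex
  have hP0 : ∀ i, P i ≠ ⊥ := fun i => Ideal.ne_bot_of_liesOver_of_ne_bot (hq0 i) (P i)
  have hPinj : Function.Injective P := by
    intro i j hij
    apply hqi
    rw [(hP2 i).over, (hP2 j).over, hij]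
  have hPτ : ∀ i, (P i).map τ = P i := by
    intro i
    have hl : ((P i).comap τ).LiesOver (q i) := by
      constructor
      rw [(hP2 i).over]
      ext x
      simp only [Ideal.under_def, Ideal.mem_comap]
      rw [hτK]
    have hpr : ((P i).comap τ).IsPrime := Ideal.comap_isPrime τ (P i)
    have := huniq i ((P i).comap τ) (P i)
    conv_lhs => rw [← this]
    exact Ideal.map_comap_of_surjective τ τ.surjective _
  have hprin : ∀ i, ∃ α : 𝓞 L, P i ^ h = Ideal.span {α} := by
    intro i
    have hm : P i ∈ nonZeroDivisors (Ideal (𝓞 L)) := mem_nonZeroDivisors_of_ne_zero (hP0 i)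
    have h1 : ClassGroup.mk0 (⟨P i, hm⟩ ^ h) = 1 := by
      rw [map_pow, hh, pow_card_eq_one']
    have h3 := (ClassGroup.mk0_eq_one_iff (pow_mem hm h)).1 h1
    exact ⟨_, (Ideal.span_singleton_generator (P i ^ h)).symm⟩
  choose α hα using hprin
  have hα0 : ∀ i, α i ≠ 0 := by
    intro i h0
    have := hα i
    rw [h0] at this
    exact pow_ne_zero h (hP0 i) (by simpa using this)
  have hu : ∀ i, ∃ u : (𝓞 L)ˣ, α i * u = τ (α i) := by
    intro i
    have : Ideal.span {α i} = Ideal.span {τ (α i)} := by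
      have e : Ideal.map τ (P i ^ h) = P i ^ h := by rw [Ideal.map_pow, hPτ]
      rw [hα, Ideal.map_span, Set.image_singleton] at e
      exact e.symm
    exact Ideal.span_singleton_eq_span_singleton.1 this
  choose u hu using hu
  let A : Finset (Fin 4) → 𝓞 L := fun S => ∏ i ∈ S, α i
  let F : Finset (Fin 4) → (𝓞 L)ˣ := fun S => ∏ i ∈ S, u i
  have hA0 : ∀ S, A S ≠ 0 := fun S => Finset.prod_ne_zero_iff.2 fun i _ => hα0 i
  have hAF : ∀ S, τ (A S) = A S * F S := by
    intro S
    simp only [A, F, map_prod, Units.coe_prod, ← Finset.prod_mul_distrib, hu]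
  let σU : (𝓞 L)ˣ →* (𝓞 L)ˣ := Units.map (τ : 𝓞 L →* 𝓞 L)
  have hσU : ∀ v : (𝓞 L)ˣ, ((σU v : (𝓞 L)ˣ) : 𝓞 L) = τ v := fun v => rfl
  have hF : ∀ S, F S * σU (F S) = 1 := by
    intro S
    apply Units.ext
    rw [Units.val_mul, hσU, Units.val_one]
    apply mul_left_cancel₀ (hA0 S)
    rw [← mul_assoc, ← hAF, ← map_mul, ← hAF, hτ2, mul_one]
  let ε' : (𝓞 L)ˣ := Units.map (algebraMap (𝓞 K) (𝓞 L) : 𝓞 K →* 𝓞 L) ε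
  have hε1 : σU ε' = ε' := Units.ext (hτK _)
  have hinj : Function.Injective (Units.map (algebraMap (𝓞 K) (𝓞 L) : 𝓞 K →* 𝓞 L)) :=
    Units.map_injective (FaithfulSMul.algebraMap_injective (𝓞 K) (𝓞 L))
  have hε2 : ∀ n : ℤ, ε' ^ n = 1 → n = 0 := by
    intro n hn
    apply hε'
    apply hinj
    rw [map_zpow, map_one]
    exact hn
  obtain ⟨S, S', hne, w, hw, hSS⟩ := units_aux L hrank σU ε' hε1 hε2 F hF
  have hw' : (w : 𝓞 L) * τ w = 1 := congrArg Units.val hw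
  have hSS' : (F S : 𝓞 L) = F S' * (w : 𝓞 L) ^ 2 := by
    have := congrArg Units.val hSS
    simpa using this
  obtain ⟨a, ha⟩ := hσfix ((A S : L) * (w : 𝓞 L) / (A S' : L)) (by
    have e1 : τ (A S * w) = A S * F S' * w := by
      rw [map_mul, hAF, hSS']
      linear_combination (A S * F S' * (w : 𝓞 L)) * hw'
    have e2 := hAF S'
    have e1' := congrArg (fun x : 𝓞 L => (x : L)) e1
    have e2' := congrArg (fun x : 𝓞 L => (x : L)) e2
    simp only [hτ, map_mul] at e1' e2'
    have n1 : (A S' : L) ≠ 0 := by simpa using hA0 S'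
    have n2 : ((F S' : 𝓞 L) : L) ≠ 0 := by simp
    rw [map_div₀, map_mul, e1', e2']
    field_simp)
  obtain ⟨n, d, hd, hnd⟩ := IsFractionRing.div_surjective (A := 𝓞 K) a
  have hd0 : d ≠ 0 := nonZeroDivisors.ne_zero hd
  have main : A S * w * algebraMap (𝓞 K) (𝓞 L) d = algebraMap (𝓞 K) (𝓞 L) n * A S' := by
    apply RingOfIntegers.ext
    have n1 : (A S' : L) ≠ 0 := by simpa using hA0 S'
    have n2 : algebraMap K L (d : K) ≠ 0 := by simpa using hd0
    rw [← hnd, map_div₀, div_eq_div_iff n2 n1] at ha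
    simp only [map_mul]
    exact ha.symm
  have hn0 : n ≠ 0 := by
    rintro rfl
    rw [map_zero, zero_mul] at main
    have : algebraMap (𝓞 K) (𝓞 L) d ≠ 0 := by simpa using hd0
    exact mul_ne_zero (mul_ne_zero (hA0 S) w.ne_zero) this main
  have hspan := congrArg (fun x => Ideal.span {x}) main
  simp only [← Ideal.span_singleton_mul_span_singleton] at hspan
  rw [Ideal.span_singleton_eq_top.2 w.isUnit, Ideal.mul_top] at hspan
  have hPpr : ∀ i, Prime (P i) := fun i => Ideal.prime_of_isPrime (hP0 i) (hP1 i)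
  have hmA : ∀ (T : Finset (Fin 4)) i, emultiplicity (P i) (Ideal.span {A T}) =
      ((if i ∈ T then h else 0 : ℕ) : ℕ∞) := by
    intro T i
    have : Ideal.span {A T} = ∏ j ∈ T, P j ^ h := by
      simp only [A, hα]
      rw [Ideal.prod_span_singleton]
    rw [this, Finset.emultiplicity_prod (hPpr i)]
    have : ∀ j, emultiplicity (P i) (P j ^ h) = if i = j then (h : ℕ∞) else 0 := by
      intro j
      split_ifs with hij
      · rw [← hij]
        exact emultiplicity_pow_self_of_prime (hPpr i) h
      · rw [emultiplicity_pow (hPpr i), emultiplicity_eq_zero.2, mul_zero]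
        intro hdvd
        exact hij (hPinj (associated_iff_eq.1 ((hPpr i).dvd_prime_iff_associated (hPpr j) |>.1 hdvd)))
    simp only [this]
    rw [Finset.sum_ite_eq]
    split_ifs <;> simp
  obtain ⟨i, hi⟩ : ∃ i, ¬ (i ∈ S ↔ i ∈ S') := by
    by_contra hcon
    push Not at hcon
    exact hne (Finset.ext hcon)
  have hm := congrArg (emultiplicity (P i)) hspan
  rw [emultiplicity_mul (hPpr i), emultiplicity_mul (hPpr i), hmA, hmA] at hm
  obtain ⟨m1, hm1⟩ := even_mult K L (q i) (hq0 i) (P i) (heven i (P i)) d hd0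
  obtain ⟨m2, hm2⟩ := even_mult K L (q i) (hq0 i) (P i) (heven i (P i)) n hn0
  rw [hm1, hm2] at hm
  have hm' : (if i ∈ S then h else 0) + 2 * m1 = 2 * m2 + (if i ∈ S' then h else 0) := by
    exact_mod_cast hm
  obtain ⟨k, hk⟩ := hodd
  by_cases c1 : i ∈ S <;> by_cases c2 : i ∈ S' <;> simp [c1, c2] at hi hm' <;> omega

theorem exists_eps (K : Type) [Field K] [NumberField K] (z : 𝓞 K) (hz : z ^ 4 = -1) :
    ∃ ε : (𝓞 K)ˣ, ∀ n : ℤ, ε ^ n = 1 → n = 0 := by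
  have ht : (z - z ^ 3) ^ 2 = 2 := by linear_combination (z ^ 2 - 2) * hz
  refine ⟨⟨1 + (z - z ^ 3), (z - z ^ 3) - 1, by linear_combination ht,
    by linear_combination ht⟩, fun n hn => ?_⟩
  obtain ⟨φ⟩ : Nonempty (K →+* ℂ) := inferInstance
  let ψ : 𝓞 K →+* ℂ := φ.comp (algebraMap (𝓞 K) K)
  set t : ℂ := ψ (z - z ^ 3) with htdef
  have ht' : t ^ 2 = 2 := by rw [htdef, ← map_pow, ht, map_ofNat]
  have h1 := congrArg (fun v : ℂˣ => ‖(v : ℂ)‖) (congrArg (Units.map (ψ : 𝓞 K →* ℂ)) hn)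
  simp only [map_zpow, map_one, Units.val_zpow_eq_zpow_val, Units.val_one, norm_zpow, norm_one] at h1
  have h2 : ‖1 + t‖ ^ n = 1 := by
    rw [← h1]
    congr 2
    simp [htdef]
  by_contra hn0
  have h3 : ‖1 + t‖ = 1 := by
    rcases (zpow_eq_one_iff_of_ne_zero₀ hn0).1 h2 with h | h
    · exact h
    · have := norm_nonneg (1 + t); linarith [h.1]
  have hs2 : ((Real.sqrt 2 : ℝ) : ℂ) ^ 2 = 2 := by
    rw [← Complex.ofReal_pow, Real.sq_sqrt (by norm_num)]; simp
  have hs := Real.sq_sqrt (show (0 : ℝ) ≤ 2 by norm_num)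
  have hsp := Real.sqrt_nonneg 2
  rcases sq_eq_sq_iff_eq_or_eq_neg.1 (ht'.trans hs2.symm) with h | h
  · have e : (1 + t) = ((1 + Real.sqrt 2 : ℝ) : ℂ) := by rw [h]; push_cast; ring
    rw [e, Complex.norm_real, Real.norm_eq_abs] at h3
    rcases eq_or_eq_neg_of_abs_eq h3 with h | h <;> nlinarith
  · have e : (1 + t) = ((1 - Real.sqrt 2 : ℝ) : ℂ) := by rw [h]; push_cast; ring
    rw [e, Complex.norm_real, Real.norm_eq_abs] at h3
    rcases eq_or_eq_neg_of_abs_eq h3 with h | h <;> nlinarith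

theorem exists_primes (p : ℕ) (hp : p.Prime) (hp8 : p % 8 = 1) (K : Type) [Field K] [NumberField K]
    [IsCyclotomicExtension {8} ℚ K] :
    ∃ q : Fin 4 → Ideal (𝓞 K), Function.Injective q ∧ ∀ i, (q i).IsPrime ∧
      (q i).LiesOver (Ideal.span {(p : ℤ)}) ∧ (q i).ramificationIdx ℤ = 1 := by
  classical
  have : Fact p.Prime := ⟨hp⟩
  have hnd : ¬ p ∣ 8 := by
    intro h
    have h1 := Nat.le_of_dvd (by norm_num) h
    have h5 : p = 1 := by omega
    exact hp.one_lt.ne' h5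
  have : IsGalois ℚ K := IsCyclotomicExtension.isGalois {8} ℚ K
  have hpz : Prime (p : ℤ) := Nat.prime_iff_prime_int.1 hp
  have : (Ideal.span {(p : ℤ)}).IsPrime := (Ideal.span_singleton_prime hpz.ne_zero).2 hpz
  have hcard := Ideal.ncard_primesOver_mul_ramificationIdxIn_mul_inertiaDegIn
    (Ideal.span {(p : ℤ)}) (𝓞 K) Gal(K/ℚ)
  have h1 : ((p : ℕ) : ZMod 8) = 1 := by
    have := (ZMod.natCast_eq_natCast_iff' p 1 8).2 (by rw [hp8])
    simpa using this
  rw [IsCyclotomicExtension.Rat.ramificationIdxIn_eq_of_not_dvd (m := 8) p K hnd,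
    IsCyclotomicExtension.Rat.inertiaDegIn_eq_of_not_dvd (m := 8) p K hnd, h1, orderOf_one,
    mul_one, mul_one, IsGalois.card_aut_eq_finrank,
    IsCyclotomicExtension.finrank (n := 8) K
      (Polynomial.cyclotomic.irreducible_rat (by norm_num))] at hcard
  have h4 : Nat.totient 8 = 4 := by decide
  rw [h4] at hcard
  have : Finite ((Ideal.span {(p : ℤ)}).primesOver (𝓞 K)) := Nat.finite_of_card_ne_zero (by
    rw [Nat.card_coe_set_eq, hcard]; norm_num)
  let e := (Finite.equivFinOfCardEq (α := (Ideal.span {(p : ℤ)}).primesOver (𝓞 K))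
    (by rw [Nat.card_coe_set_eq, hcard])).symm
  refine ⟨fun i => (e i).1, fun i j h => e.injective (Subtype.ext h), fun i => ?_⟩
  obtain ⟨hi1, hi2⟩ := (e i).2
  exact ⟨hi1, hi2, IsCyclotomicExtension.Rat.ramificationIdx_eq_of_not_dvd (m := 8) p K _ hnd⟩

/-- Let `p ≡ 1 (mod 8)` be a prime. Then the class number of `L_p = ℚ(ζ₈, √p)` is even. -/
theorem stmt_13 (p : ℕ) (hp : p.Prime) (hp8 : p % 8 = 1)
    (L : Type) [Field L] [NumberField L]
    (ζ : L) (hζ : IsPrimitiveRoot ζ 8) (s : L) (hs : s ^ 2 = (p : L))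
    (hgen : Algebra.adjoin ℚ {ζ, s} = ⊤) :
    Even (Nat.card (ClassGroup (𝓞 L))) := by
  let K : IntermediateField ℚ L := IntermediateField.adjoin ℚ {ζ}
  have hcyc : IsCyclotomicExtension {8} ℚ K :=
    hζ.intermediateField_adjoin_isCyclotomicExtension ℚ
  have h4 : Module.finrank ℚ K = 4 := by
    rw [IsCyclotomicExtension.finrank (n := 8) K
      (Polynomial.cyclotomic.irreducible_rat (by norm_num))]
    decide
  have hζK : ζ ∈ K := IntermediateField.mem_adjoin_simple_self ℚ ζ
  have hζ4 : ζ ^ 4 = -1 := by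
    have h8 := hζ.pow_eq_one
    have hne : ζ ^ 4 ≠ 1 := hζ.pow_ne_one_of_pos_of_lt (by norm_num) (by norm_num)
    have : (ζ ^ 4 - 1) * (ζ ^ 4 + 1) = 0 := by linear_combination h8
    rcases mul_eq_zero.1 this with h | h
    · exact absurd (sub_eq_zero.1 h) hne
    · exact eq_neg_of_add_eq_zero_left h
  have hsint : IsIntegral ℤ s := by
    apply IsIntegral.of_pow (n := 2) (by norm_num)
    rw [hs]
    simpa using isIntegral_algebraMap (R := ℤ) (A := L) (x := (p : ℤ))
  have h2 : Module.finrank K L ≤ 2 := by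
    have hsi : IsIntegral K s := hsint.tower_top
    have htop : IntermediateField.adjoin K {s} = ⊤ := by
      have hle : Algebra.adjoin ℚ {ζ, s} ≤
          ((IntermediateField.adjoin K {s}).restrictScalars ℚ).toSubalgebra := by
        rw [Algebra.adjoin_le_iff]
        rintro x (rfl | rfl)
        · exact (IntermediateField.adjoin K {s}).algebraMap_mem ⟨x, hζK⟩
        · exact IntermediateField.mem_adjoin_simple_self K x
      rw [hgen] at hle
      rw [eq_top_iff]
      intro x _
      exact hle (Algebra.mem_top : x ∈ (⊤ : Subalgebra ℚ L))
    rw [← IntermediateField.finrank_top' (F := K) (E := L), ← htop,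
      IntermediateField.adjoin.finrank hsi]
    have hX : (Polynomial.X ^ 2 - Polynomial.C (p : K)).natDegree = 2 :=
      Polynomial.natDegree_X_pow_sub_C
    rw [← hX]
    apply Polynomial.natDegree_le_of_dvd
    · apply minpoly.dvd
      simp [hs]
    · intro h0
      rw [h0] at hX
      simp at hX
  have hrank : NumberField.Units.rank L ≤ 3 := by
    have h8 : Module.finrank ℚ L ≤ 8 := by
      rw [← Module.finrank_mul_finrank ℚ K L, h4]
      omega
    have hr := NumberField.InfinitePlace.IsPrimitiveRoot.nrRealPlaces_eq_zero_of_two_lt (K := L) (by norm_num) hζ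
    have hc := InfinitePlace.card_add_two_mul_card_eq_rank L
    have hcard := InfinitePlace.card_eq_nrRealPlaces_add_nrComplexPlaces L
    rw [NumberField.Units.rank, hcard]
    omega
  let z : 𝓞 K := ⟨⟨ζ, hζK⟩, by
    apply IsIntegral.of_pow (n := 8) (by norm_num)
    have : (⟨ζ, hζK⟩ : K) ^ 8 = 1 := Subtype.ext (by simpa using hζ.pow_eq_one)
    rw [this]
    exact isIntegral_one⟩
  have hz : z ^ 4 = -1 := FaithfulSMul.algebraMap_injective (𝓞 K) K (by
    rw [map_pow, map_neg, map_one]; exact Subtype.ext hζ4)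
  obtain ⟨ε, hε⟩ := exists_eps K z hz
  obtain ⟨q, hqi, hq⟩ := exists_primes p hp hp8 K
  have hpbot : Ideal.span {(p : ℤ)} ≠ ⊥ := by
    simpa [Ideal.span_singleton_eq_bot] using hp.ne_zero
  let s' : 𝓞 L := ⟨s, hsint⟩
  have hs' : s' ^ 2 = (p : 𝓞 L) := FaithfulSMul.algebraMap_injective (𝓞 L) L (by
    rw [map_pow, map_natCast]; exact hs)
  refine core K L h2 hrank q hqi (fun i => (hq i).1) (fun i => ?_) (fun i => ?_) ε hε
  · have := (hq i).2.1
    exact Ideal.ne_bot_of_liesOver_of_ne_bot hpbot (q i)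
  · intro P _ _
    have := (hq i).1
    have := (hq i).2.1
    exact even_ram p hp K L s' hs' (q i) (hq i).2.2 P
end
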